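/- Let K be a field with a surjective additive valuation v : K → ℝ∞. Let Δ ∈ K[x_{000},x_{001},x_{010},x_{011},x_{100},x_{101},x_{110},x_{111}] be Cayley's 2×2×2 hyperdeterminant: Δ = x_{000}²x_{111}² + x_{001}²x_{110}² + x_{010}²x_{101}² + x_{100}²x_{011}² − 2x_{000}x_{001}x_{110}x_{111} − 2x_{000}x_{010}x_{101}x_{111} − 2x_{000}x_{011}x_{100}x_{111} − 2x_{001}x_{010}x_{101}x_{110} − 2x_{001}x_{011}x_{110}x_{100} − 2x_{010}x_{011}x_{101}x_{100} + 4x_{000}x_{011}x_{101}x_{110} + 4x_{001}x_{010}x_{100}x_{111}, and let I := (Δ), B := K[x]/I. Take m := 6 with ℤ^6 identified with ℤ²×ℤ²×ℤ² and weights a_{ijk} := (e_i, e_j, e_k); then I is weight-homogeneous and μ : ℝ^6 × X^an → X^an is defined. Let Trop(X^0) := {ξ ∈ ℝ^8 : there exists w ∈ X^an with w(x̄_{ijk}) = ξ_{ijk} for all i,j,k}, with the subspace topology of ℝ^8. Then there exists a continuous map σ : Trop(X^0) → X^an such that trop(σ(ξ)) = ξ for all ξ ∈ Trop(X^0), and which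 is ℝ²×ℝ²×ℝ²-equivariant: for every ξ ∈ Trop(X^0) and τ ∈ ℝ^6, the point ξ + Aτ (where (Aτ)_{ijk} := a_{ijk}·τ) lies in Trop(X^0) and σ(ξ + Aτ) = μ(τ, σ(ξ)). -/

import Mathlib

open scoped Classical

noncomputable section

/-- `ℝ∞ = ℝ ∪ {∞}`, with the order topology. -/
abbrev RInf := WithTop ℝ

noncomputable instance : TopologicalSpace RInf := Preorder.topology RInf
instance : OrderTopology RInf := ⟨rfl⟩

/-- An additive (non-Archimedean) valuation on a commutative ring, with values in
`ℝ∞`: `w(ab) = w(a) + w(b)`, `w(a+b) ≥ min (w a) (w b)`, `w 1 = 0`, `w 0 = ∞`. -/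
structure IsVal {R : Type*} [CommRing R] (w : R → RInf) : Prop where
  map_mul : ∀ a b, w (a * b) = w a + w b
  min_le_add : ∀ a b, min (w a) (w b) ≤ w (a + b)
  map_one : w 1 = 0
  map_zero : w 0 = ⊤

/-- The analytification of `Spec B`: the set of additive valuations on the `K`-algebra
`B` extending the valuation `v` on `K`, as a subset of the product space `B → ℝ∞`
(topology of pointwise convergence). -/
def An {K : Type*} [Field K] (v : K → RInf) (B : Type*) [CommRing B] [Algebra K B] :
    Set (B → RInf) :=
  {w | IsVal w ∧ ∀ c : K, w (algebraMap K B c) = v c}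

variable {K : Type*} [Field K] {ι M : Type*} [Fintype M]

/-- Weight of a monomial exponent `α` with respect to weight vectors `a`. -/
def wt (a : ι → M → ℤ) (α : ι →₀ ℕ) : M → ℤ :=
  α.sum fun i k => (k : ℤ) • a i

/-- The weight-`β` component `F_β` of a polynomial `F`: the sum of the terms `c·x^α`
of `F` with `Σ_i α_i a_i = β`. -/
def wtComp (a : ι → M → ℤ) (F : MvPolynomial ι K) (β : M → ℤ) : MvPolynomial ι K :=
  ∑ α ∈ F.support.filter (fun α => wt a α = β), MvPolynomial.monomial α (F.coeff α)

/-- An ideal is weight-homogeneous if it contains all weight components of its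
members. -/
def WtHomog (a : ι → M → ℤ) (I : Ideal (MvPolynomial ι K)) : Prop :=
  ∀ F ∈ I, ∀ β : M → ℤ, wtComp a F β ∈ I

/-- Pairing `β·τ` of an integer vector with a real vector. -/
def pairR (β : M → ℤ) (τ : M → ℝ) : ℝ := ∑ j, (β j : ℝ) * τ j

/-- `ν(F) = min_β (w(F̄_β) + β·τ)`: the minimum over the finitely many `β` with
`F_β ≠ 0`, with value `∞` for `F = 0`. -/
def muAux (a : ι → M → ℤ) (I : Ideal (MvPolynomial ι K))
    (w : (MvPolynomial ι K ⧸ I) → RInf) (τ : M → ℝ) (F : MvPolynomial ι K) : RInf :=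
  (F.support.image (wt a)).inf fun β =>
    w (Ideal.Quotient.mk I (wtComp a F β)) + ((pairR β τ : ℝ) : RInf)

/-- `μ(τ,w) : B → ℝ∞`, computed on an arbitrary lift of `f` (for weight-homogeneous
`I` this is independent of the lift). -/
def mu (a : ι → M → ℤ) (I : Ideal (MvPolynomial ι K)) (τ : M → ℝ)
    (w : (MvPolynomial ι K ⧸ I) → RInf) : (MvPolynomial ι K ⧸ I) → RInf :=
  fun f => muAux a I w τ (Function.surjInv Ideal.Quotient.mk_surjective f)

/-- The tropicalisation map `X^an → ℝ∞^ι`, `w ↦ (w(x̄_i))_i`. -/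
def tropMap (I : Ideal (MvPolynomial ι K)) (w : (MvPolynomial ι K ⧸ I) → RInf) :
    ι → RInf :=
  fun i => w (Ideal.Quotient.mk I (MvPolynomial.X i))

/-- `Trop(X)`: the image of the analytification under `trop`, inside `ℝ∞^ι`. -/
def TropSet (v : K → RInf) (I : Ideal (MvPolynomial ι K)) : Set (ι → RInf) :=
  {η | ∃ w ∈ An v (MvPolynomial ι K ⧸ I), tropMap I w = η}

/-- `Trop(X⁰)`: the points of `Trop(X)` with all coordinates finite, inside `ℝ^ι`. -/
def TropSet0 (v : K → RInf) (I : Ideal (MvPolynomial ι K)) : Set (ι → ℝ) :=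
  {ξ | ∃ w ∈ An v (MvPolynomial ι K ⧸ I), ∀ i, tropMap I w i = ((ξ i : ℝ) : RInf)}

end

open MvPolynomial in
/-- Cayley's `2×2×2` hyperdeterminant. -/
noncomputable def cayley (K : Type*) [Field K] :
    MvPolynomial (Fin 2 × Fin 2 × Fin 2) K :=
  X (0,0,0) ^ 2 * X (1,1,1) ^ 2 + X (0,0,1) ^ 2 * X (1,1,0) ^ 2
    + X (0,1,0) ^ 2 * X (1,0,1) ^ 2 + X (1,0,0) ^ 2 * X (0,1,1) ^ 2
    - 2 * (X (0,0,0) * X (0,0,1) * X (1,1,0) * X (1,1,1))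
    - 2 * (X (0,0,0) * X (0,1,0) * X (1,0,1) * X (1,1,1))
    - 2 * (X (0,0,0) * X (0,1,1) * X (1,0,0) * X (1,1,1))
    - 2 * (X (0,0,1) * X (0,1,0) * X (1,0,1) * X (1,1,0))
    - 2 * (X (0,0,1) * X (0,1,1) * X (1,1,0) * X (1,0,0))
    - 2 * (X (0,1,0) * X (0,1,1) * X (1,0,1) * X (1,0,0))
    + 4 * (X (0,0,0) * X (0,1,1) * X (1,0,1) * X (1,1,0))
    + 4 * (X (0,0,1) * X (0,1,0) * X (1,0,0) * X (1,1,1))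

/-- The weights `a_{ijk} = (e_i, e_j, e_k) ∈ ℤ² × ℤ² × ℤ² ≅ ℤ⁶`. -/
noncomputable def cayleyWt : Fin 2 × Fin 2 × Fin 2 → (Fin 2 ⊕ Fin 2 ⊕ Fin 2) → ℤ :=
  fun e => Sum.elim (Pi.single e.1 1)
    (Sum.elim (Pi.single e.2.1 1) (Pi.single e.2.2 1))

noncomputable section

namespace IsVal

variable {R : Type*} [CommRing R] {w : R → RInf}

lemma map_neg_one (hw : IsVal w) : w (-1) = 0 := by
  have h : w (-1) + w (-1) = 0 := by rw [← hw.map_mul]; simp [hw.map_one]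
  have ht : w (-1) ≠ ⊤ := fun hx => by simp [hx] at h
  lift w (-1) to ℝ using ht with x
  norm_cast at h ⊢
  linarith

lemma map_neg (hw : IsVal w) (a : R) : w (-a) = w a := by
  rw [← neg_one_mul, hw.map_mul, hw.map_neg_one, zero_add]

lemma le_sum (hw : IsVal w) {ι : Type*} (s : Finset ι) (t : ι → R) (r : RInf)
    (h : ∀ i ∈ s, r ≤ w (t i)) : r ≤ w (∑ i ∈ s, t i) := by
  induction s using Finset.cons_induction with
  | empty => simp [hw.map_zero]
  | cons i s hi ih =>
    rw [Finset.sum_cons]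
    exact (le_min (h i (by simp)) (ih fun j hj => h j (by simp [hj]))).trans (hw.min_le_add _ _)

lemma lt_sum (hw : IsVal w) {ι : Type*} (s : Finset ι) (t : ι → R) (r : RInf) (hr : r < ⊤)
    (h : ∀ i ∈ s, r < w (t i)) : r < w (∑ i ∈ s, t i) := by
  induction s using Finset.cons_induction with
  | empty => simpa [hw.map_zero] using hr
  | cons i s hi ih =>
    rw [Finset.sum_cons]
    exact (lt_min (h i (by simp)) (ih fun j hj => h j (by simp [hj]))).trans_le
      (hw.min_le_add _ _)

lemma add_eq_of_lt (hw : IsVal w) {a b : R} (h : w a < w b) : w (a + b) = w a := by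
  refine le_antisymm ?_ (by simpa [h.le] using hw.min_le_add a b)
  by_contra! hlt
  have := hw.min_le_add (a + b) (-b)
  rw [add_neg_cancel_right, hw.map_neg] at this
  exact absurd this (not_le.2 (lt_min hlt h))

lemma map_prod (hw : IsVal w) {ι : Type*} (s : Finset ι) (t : ι → R) :
    w (∏ i ∈ s, t i) = ∑ i ∈ s, w (t i) := by
  induction s using Finset.cons_induction with
  | empty => simp [hw.map_one]
  | cons i s hi ih => rw [Finset.prod_cons, Finset.sum_cons, hw.map_mul, ih]

lemma map_pow (hw : IsVal w) (a : R) (n : ℕ) : w (a ^ n) = n • w a := by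
  induction n with
  | zero => simp [hw.map_one]
  | succ n ih => rw [pow_succ, hw.map_mul, ih, succ_nsmul]

lemma comp {S : Type*} [CommRing S] (hw : IsVal w) (f : S →+* R) : IsVal fun s => w (f s) where
  map_mul a b := by rw [_root_.map_mul, hw.map_mul]
  min_le_add a b := by rw [map_add]; exact hw.min_le_add _ _
  map_one := by rw [_root_.map_one, hw.map_one]
  map_zero := by rw [_root_.map_zero, hw.map_zero]

lemma two_nonneg (hw : IsVal w) : 0 ≤ w 2 := by
  have := hw.min_le_add 1 1
  rwa [hw.map_one, min_self, one_add_one_eq_two] at this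

/-- If finitely many elements sum to zero, no single one of them has strictly smallest
finite valuation. -/
lemma exists_ne_le_of_sum_eq_zero (hw : IsVal w) {ι : Type*} [Fintype ι] (t : ι → R)
    (h : ∑ i, t i = 0) (j : ι) (hj : w (t j) < ⊤) : ∃ i, i ≠ j ∧ w (t i) ≤ w (t j) := by
  by_contra! hlt
  rw [← Finset.add_sum_erase _ _ (Finset.mem_univ j)] at h
  have h2 := hw.lt_sum (Finset.univ.erase j) t _ hj fun i hi => hlt i (Finset.ne_of_mem_erase hi)
  have h3 := hw.add_eq_of_lt h2
  rw [h, hw.map_zero] at h3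
  exact hj.ne h3.symm

end IsVal

section Gauss

variable {R G : Type*} [CommRing R]

/-- The Gauss extension of a valuation `w` on `R` to the monoid algebra `R[G]`, where the
monomial with exponent `g` has valuation `ρ g`. -/
def gauss (w : R → RInf) (ρ : G → ℝ) (f : AddMonoidAlgebra R G) : RInf :=
  f.coeff.support.inf fun g => w (f.coeff g) + (ρ g : RInf)

variable {w : R → RInf} {ρ : G → ℝ}

lemma gauss_eq_inf (h0 : w 0 = ⊤) (f : AddMonoidAlgebra R G) {s : Finset G}
    (hs : f.coeff.support ⊆ s) :
    gauss w ρ f = s.inf fun g => w (f.coeff g) + (ρ g : RInf) := by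
  refine le_antisymm (Finset.le_inf fun g _ => ?_) (Finset.inf_mono hs)
  by_cases hg : g ∈ f.coeff.support
  · exact Finset.inf_le hg
  · simp [Finsupp.notMem_support_iff.1 hg, h0]

lemma gauss_le (h0 : w 0 = ⊤) (f : AddMonoidAlgebra R G) (g : G) :
    gauss w ρ f ≤ w (f.coeff g) + (ρ g : RInf) := by
  rw [gauss_eq_inf h0 f (Finset.subset_insert g _)]
  exact Finset.inf_le (Finset.mem_insert_self _ _)

lemma gauss_single (h0 : w 0 = ⊤) (g : G) (c : R) :
    gauss w ρ (AddMonoidAlgebra.single g c) = w c + (ρ g : RInf) := by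
  rw [gauss_eq_inf h0 (s := {g}) _ (by
    rw [AddMonoidAlgebra.coeff_single]; exact Finsupp.support_single_subset)]
  simp

lemma exists_gauss_eq {f : AddMonoidAlgebra R G} (hf : gauss w ρ f ≠ ⊤) :
    ∃ g ∈ f.coeff.support, w (f.coeff g) + (ρ g : RInf) = gauss w ρ f := by
  have hne : f.coeff.support.Nonempty := by
    by_contra h
    rw [Finset.not_nonempty_iff_eq_empty] at h
    exact hf (by simp [gauss, h])
  obtain ⟨g, hg, h⟩ := Finset.exists_mem_eq_inf _ hne fun g => w (f.coeff g) + (ρ g : RInf)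
  exact ⟨g, hg, h.symm⟩

/-- Gauss's lemma: the Gauss extension of a valuation is a valuation. -/
lemma IsVal.gauss [AddCommMonoid G] [UniqueSums G] (hw : IsVal w) (ρ : G →+ ℝ) :
    IsVal (gauss w ρ) where
  map_zero := by simp [_root_.gauss]
  map_one := by
    rw [AddMonoidAlgebra.one_def, gauss_single hw.map_zero, hw.map_one]
    simp
  min_le_add a b := by
    refine Finset.le_inf fun g _ => ?_
    rw [AddMonoidAlgebra.coeff_add, Finsupp.add_apply]
    refine le_trans ?_ (add_le_add_left (hw.min_le_add _ _) _)
    rw [min_add]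
    exact min_le_min (gauss_le hw.map_zero _ _) (gauss_le hw.map_zero _ _)
  map_mul a b := by
    have hterm : ∀ x y, _root_.gauss w ρ a + _root_.gauss w ρ b ≤
        w (a.coeff x * b.coeff y) + (ρ (x + y) : RInf) := fun x y => by
      rw [hw.map_mul, map_add, WithTop.coe_add, add_add_add_comm]
      exact add_le_add (gauss_le hw.map_zero _ _) (gauss_le hw.map_zero _ _)
    have hcoeff : ∀ g, (a * b).coeff g = ∑ p ∈ a.coeff.support ×ˢ b.coeff.support,
        if p.1 + p.2 = g then a.coeff p.1 * b.coeff p.2 else 0 := fun g => by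
      rw [AddMonoidAlgebra.coeff_mul, Finset.sum_product]
      rfl
    have hcancel : ∀ (x : ℝ) {p q : RInf}, p + x ≤ q + x → p ≤ q := fun x p q h =>
      (WithTop.add_le_add_iff_right WithTop.coe_ne_top).1 h
    have hle : _root_.gauss w ρ a + _root_.gauss w ρ b ≤ _root_.gauss w ρ (a * b) := by
      refine Finset.le_inf fun g _ => ?_
      have : _root_.gauss w ρ a + _root_.gauss w ρ b + ((-ρ g : ℝ) : RInf)
          ≤ w ((a * b).coeff g) := by
        rw [hcoeff]
        refine hw.le_sum _ _ _ fun p _ => ?_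
        split_ifs with hp
        · refine hcancel (ρ g) ?_
          rw [add_assoc, ← WithTop.coe_add, neg_add_cancel, WithTop.coe_zero, add_zero, ← hp]
          exact hterm _ _
        · simp [hw.map_zero]
      have h2 := add_le_add_left this (ρ g : RInf)
      rwa [add_assoc, ← WithTop.coe_add, neg_add_cancel, WithTop.coe_zero, add_zero] at h2
    refine le_antisymm ?_ hle
    by_cases ha : _root_.gauss w ρ a = ⊤
    · simp [ha]
    by_cases hb : _root_.gauss w ρ b = ⊤
    · simp [hb]
    obtain ⟨x, hx, hxe⟩ := exists_gauss_eq ha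
    obtain ⟨y, hy, hye⟩ := exists_gauss_eq hb
    obtain ⟨a0, ha0, b0, hb0, hu⟩ := UniqueSums.uniqueAdd_of_nonempty
      (A := a.coeff.support.filter fun g => w (a.coeff g) + (ρ g : RInf) = _root_.gauss w ρ a)
      (B := b.coeff.support.filter fun g => w (b.coeff g) + (ρ g : RInf) = _root_.gauss w ρ b)
      ⟨x, Finset.mem_filter.2 ⟨hx, hxe⟩⟩ ⟨y, Finset.mem_filter.2 ⟨hy, hye⟩⟩
    rw [Finset.mem_filter] at ha0 hb0
    have hmain : w (a.coeff a0 * b.coeff b0) + (ρ (a0 + b0) : RInf)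
        = _root_.gauss w ρ a + _root_.gauss w ρ b := by
      rw [hw.map_mul, map_add, WithTop.coe_add, add_add_add_comm, ha0.2, hb0.2]
    have hfin : w (a.coeff a0 * b.coeff b0) < ⊤ := by
      rw [lt_top_iff_ne_top]
      intro h
      rw [h, top_add] at hmain
      exact WithTop.add_ne_top.2 ⟨ha, hb⟩ hmain.symm
    have hval : w ((a * b).coeff (a0 + b0)) = w (a.coeff a0 * b.coeff b0) := by
      rw [hcoeff, ← Finset.add_sum_erase _ _
        (Finset.mk_mem_product ha0.1 hb0.1), if_pos rfl]
      refine hw.add_eq_of_lt (hw.lt_sum _ _ _ hfin fun p hp => ?_)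
      rw [Finset.mem_erase, Finset.mem_product] at hp
      split_ifs with hs
      · refine lt_of_not_ge fun hge => hp.1 ?_
        have h3 : w (a.coeff p.1 * b.coeff p.2) + (ρ (p.1 + p.2) : RInf)
            ≤ _root_.gauss w ρ a + _root_.gauss w ρ b := by
          rw [← hmain, hs]
          exact add_le_add_left hge _
        rw [hw.map_mul, map_add, WithTop.coe_add, add_add_add_comm] at h3
        have h1 := gauss_le (ρ := ρ) hw.map_zero a p.1
        have h2 := gauss_le (ρ := ρ) hw.map_zero b p.2
        have e1 : w (a.coeff p.1) + (ρ p.1 : RInf) = _root_.gauss w ρ a := by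
          refine le_antisymm ?_ h1
          exact (WithTop.add_le_add_iff_right hb).1 ((add_le_add_right h2 _).trans h3)
        have e2 : w (b.coeff p.2) + (ρ p.2 : RInf) = _root_.gauss w ρ b := by
          refine le_antisymm ?_ h2
          exact (WithTop.add_le_add_iff_left ha).1 ((add_le_add_left h1 _).trans h3)
        obtain ⟨q1, q2⟩ := hu (Finset.mem_filter.2 ⟨hp.2.1, e1⟩)
          (Finset.mem_filter.2 ⟨hp.2.2, e2⟩) hs
        exact Prod.ext q1 q2
      · rwa [hw.map_zero]
    calc _root_.gauss w ρ (a * b) ≤ _ := gauss_le hw.map_zero _ (a0 + b0)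
      _ = _ := by rw [hval, hmain]

end Gauss

section MvGauss

variable {K ι : Type*} [Field K] {v : K → RInf}

/-- The Gauss valuation on a polynomial ring for which the variable `X i` has valuation `ρ i`. -/
def mvGauss (v : K → RInf) (ρ : ι → ℝ) (P : MvPolynomial ι K) : RInf :=
  gauss v (Finsupp.linearCombination ℕ ρ) P

lemma mvGauss_isVal (hv : IsVal v) (ρ : ι → ℝ) : IsVal (mvGauss v ρ) :=
  hv.gauss (Finsupp.linearCombination ℕ ρ).toAddMonoidHom

lemma mvGauss_monomial (hv : IsVal v) (ρ : ι → ℝ) (α : ι →₀ ℕ) (c : K) :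
    mvGauss v ρ (MvPolynomial.monomial α c)
      = v c + ((Finsupp.linearCombination ℕ ρ α : ℝ) : RInf) :=
  gauss_single hv.map_zero α c

lemma mvGauss_C (hv : IsVal v) (ρ : ι → ℝ) (c : K) : mvGauss v ρ (MvPolynomial.C c) = v c := by
  rw [← MvPolynomial.monomial_zero', mvGauss_monomial hv]
  simp

lemma mvGauss_linear [Fintype ι] (hv : IsVal v) (ρ : ι → ℝ) (c : ι → K) :
    mvGauss v ρ (∑ i, MvPolynomial.C (c i) * MvPolynomial.X i)
      = Finset.univ.inf fun i => v (c i) + (ρ i : RInf) := by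
  have hterm : ∀ i, mvGauss v ρ (MvPolynomial.C (c i) * MvPolynomial.X i)
      = v (c i) + (ρ i : RInf) := fun i => by
    rw [MvPolynomial.C_mul_X_eq_monomial, mvGauss_monomial hv]
    simp
  refine le_antisymm (Finset.le_inf fun i _ => ?_)
    ((mvGauss_isVal hv ρ).le_sum _ _ _ fun i _ => ?_)
  · have h := gauss_le (ρ := Finsupp.linearCombination ℕ ρ) hv.map_zero
      (∑ i, MvPolynomial.C (c i) * MvPolynomial.X i : MvPolynomial ι K) (Finsupp.single i 1)
    have hc : MvPolynomial.coeff (Finsupp.single i 1)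
        (∑ i, MvPolynomial.C (c i) * MvPolynomial.X i) = c i := by
      simp [MvPolynomial.coeff_sum, MvPolynomial.coeff_C_mul, MvPolynomial.coeff_X,
        Finsupp.single_left_inj]
    refine h.trans_eq ?_
    change v (MvPolynomial.coeff _ _) + _ = _
    rw [hc]
    simp
  · rw [hterm]
    exact Finset.inf_le (Finset.mem_univ i)

/-- The Gauss valuation is the smallest valuation extending `v` with given values on the
variables. -/
lemma mvGauss_le_map (hv : IsVal v) {ρ : ι → ℝ} {A : Type*} [CommRing A] [Algebra K A]
    {w : A → RInf} (hw : w ∈ An v A) (θ : MvPolynomial ι K →ₐ[K] A)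
    (h : ∀ i, (ρ i : RInf) ≤ w (θ (MvPolynomial.X i))) (P : MvPolynomial ι K) :
    mvGauss v ρ P ≤ w (θ P) := by
  have key : ∀ α : ι →₀ ℕ, ((Finsupp.linearCombination ℕ ρ α : ℝ) : RInf)
      ≤ w (α.prod fun i n => θ (MvPolynomial.X i) ^ n) := fun α => by
    rw [Finsupp.prod, hw.1.map_prod, Finsupp.linearCombination_apply, Finsupp.sum,
      WithTop.coe_sum]
    refine Finset.sum_le_sum fun i _ => ?_
    rw [hw.1.map_pow, WithTop.coe_nsmul]
    exact nsmul_le_nsmul_right (h i) _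
  conv_rhs => rw [P.as_sum, map_sum]
  refine hw.1.le_sum _ _ _ fun α _ => ?_
  rw [MvPolynomial.monomial_eq, _root_.map_mul, hw.1.map_mul, ← MvPolynomial.algebraMap_eq,
    AlgHom.commutes, hw.2, Finsupp.prod, map_prod]
  simp_rw [_root_.map_pow]
  exact (gauss_le (ρ := Finsupp.linearCombination ℕ ρ) hv.map_zero P α).trans
    (add_le_add_right (key α) _)

lemma continuous_const_add_coe {X : Type*} [TopologicalSpace X] (c : RInf) {f : X → ℝ}
    (hf : Continuous f) : Continuous fun x => c + (f x : RInf) := by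
  have hcoe : Continuous ((↑) : ℝ → RInf) := WithTop.continuous_coe
  induction c using WithTop.recTopCoe with
  | top => simpa using continuous_const
  | coe c =>
    simp_rw [← WithTop.coe_add]
    exact hcoe.comp (continuous_const.add hf)

lemma continuous_finset_inf {X ι : Type*} [TopologicalSpace X] (s : Finset ι)
    (f : ι → X → RInf) (hf : ∀ i, Continuous (f i)) : Continuous fun x => s.inf fun i => f i x := by
  induction s using Finset.cons_induction with
  | empty => simpa using continuous_const
  | cons i s hi ih =>
    simp_rw [Finset.inf_cons]
    exact (hf i).min ih

lemma finset_inf_add {ι : Type*} (s : Finset ι) (f : ι → RInf) (r : ℝ) :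
    s.inf f + (r : RInf) = s.inf fun i => f i + (r : RInf) := by
  induction s using Finset.cons_induction with
  | empty => simp
  | cons i s hi ih =>
    rw [Finset.inf_cons, Finset.inf_cons, ← ih]
    exact min_add _ _ _

lemma continuous_mvGauss_add {X : Type*} [TopologicalSpace X] {ρ : X → ι → ℝ}
    (hρ : Continuous ρ) {f : X → ℝ} (hf : Continuous f) (P : MvPolynomial ι K) :
    Continuous fun x => mvGauss v (ρ x) P + (f x : RInf) := by
  simp_rw [mvGauss, gauss, finset_inf_add, add_assoc, ← WithTop.coe_add]
  refine continuous_finset_inf _ _ fun α => continuous_const_add_coe _ (Continuous.add ?_ hf)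
  simp_rw [Finsupp.linearCombination_apply, Finsupp.sum]
  refine continuous_finsetSum _ fun i _ => ?_
  have h : Continuous fun x => ρ x i := (continuous_apply i).comp hρ
  simp_rw [nsmul_eq_mul]
  exact continuous_const.mul h

end MvGauss

section Torus

variable {K ι M A : Type*} [Field K] [CommRing A] [Algebra K A]

/-- The comorphism `x_i ↦ t^{a_i} p_i` of the torus action on the point `p`. -/
def torusHom (a : ι → M → ℤ) (p : ι → A) :
    MvPolynomial ι K →ₐ[K] AddMonoidAlgebra A (M → ℤ) :=
  MvPolynomial.aeval fun i => AddMonoidAlgebra.single (a i) (p i)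

lemma torusHom_monomial (a : ι → M → ℤ) (p : ι → A) (α : ι →₀ ℕ) (c : K) :
    torusHom a p (MvPolynomial.monomial α c)
      = AddMonoidAlgebra.single (wt a α) (MvPolynomial.aeval p (MvPolynomial.monomial α c)) := by
  have h : (α.prod fun i k => (AddMonoidAlgebra.single (a i) (p i) : AddMonoidAlgebra A (M → ℤ)) ^ k)
      = AddMonoidAlgebra.single (wt a α) (α.prod fun i k => p i ^ k) := by
    rw [Finsupp.prod, Finsupp.prod, wt, Finsupp.sum]
    induction α.support using Finset.cons_induction with
    | empty => rfl
    | cons i s hi ih =>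
      rw [Finset.prod_cons, ih, Finset.prod_cons, Finset.sum_cons, AddMonoidAlgebra.single_pow,
        AddMonoidAlgebra.single_mul_single]
      simp
  rw [torusHom, MvPolynomial.aeval_monomial, MvPolynomial.aeval_monomial, h]
  simp [AddMonoidAlgebra.coe_algebraMap, AddMonoidAlgebra.single_mul_single]

variable [Fintype M]

/-- The pairing with `τ` as an additive homomorphism. -/
def pairHom (τ : M → ℝ) : (M → ℤ) →+ ℝ where
  toFun β := pairR β τ
  map_zero' := by simp [pairR]
  map_add' β γ := by simp [pairR, add_mul, Finset.sum_add_distrib]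

lemma pairR_wt (a : ι → M → ℤ) (α : ι →₀ ℕ) (τ : M → ℝ) :
    pairR (wt a α) τ = α.sum fun i k => (k : ℝ) * pairR (a i) τ := by
  have h : ∀ β, pairR β τ = pairHom τ β := fun _ => rfl
  simp_rw [h, wt, Finsupp.sum, map_sum, map_zsmul]
  simp

lemma pairR_add (β : M → ℤ) (τ δ : M → ℝ) : pairR β (τ + δ) = pairR β τ + pairR β δ := by
  simp [pairR, mul_add, Finset.sum_add_distrib]

lemma coeff_torusHom (a : ι → M → ℤ) (p : ι → A) (F : MvPolynomial ι K) (β : M → ℤ) :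
    (torusHom a p F).coeff β = MvPolynomial.aeval p (wtComp a F β) := by
  conv_lhs => rw [F.as_sum, map_sum]
  simp_rw [torusHom_monomial, AddMonoidAlgebra.coeff_sum, Finsupp.finsetSum_apply]
  rw [wtComp, map_sum, Finset.sum_filter]
  refine Finset.sum_congr rfl fun α _ => ?_
  rw [AddMonoidAlgebra.coeff_single, Finsupp.single_apply]

lemma support_torusHom_subset (a : ι → M → ℤ) (p : ι → A) (F : MvPolynomial ι K) :
    (torusHom a p F).coeff.support ⊆ F.support.image (wt a) := by
  intro β hβ
  rw [Finsupp.mem_support_iff, coeff_torusHom] at hβ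
  by_contra h
  refine hβ ?_
  rw [wtComp, Finset.filter_eq_empty_iff.2, Finset.sum_empty, map_zero]
  exact fun α hα hw => h (Finset.mem_image.2 ⟨α, hα, hw⟩)

lemma torusHom_wtComp (a : ι → M → ℤ) (p : ι → A) (F : MvPolynomial ι K) (β : M → ℤ) :
    torusHom a p (wtComp a F β)
      = AddMonoidAlgebra.single β (MvPolynomial.aeval p (wtComp a F β)) := by
  change _ = AddMonoidAlgebra.singleAddHom β _
  rw [wtComp, map_sum, map_sum, map_sum]
  refine Finset.sum_congr rfl fun α hα => ?_
  rw [torusHom_monomial, (Finset.mem_filter.1 hα).2]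
  rfl

lemma wtHomog_span_singleton (a : ι → M → ℤ) {D : MvPolynomial ι K} {β₀ : M → ℤ}
    (hD : torusHom a (MvPolynomial.X : ι → MvPolynomial ι K) D = AddMonoidAlgebra.single β₀ D) :
    WtHomog a (Ideal.span {D}) := by
  intro F hF β
  obtain ⟨G, rfl⟩ := Ideal.mem_span_singleton'.1 hF
  have h := coeff_torusHom a (MvPolynomial.X : ι → MvPolynomial ι K) (G * D) β
  rw [MvPolynomial.aeval_X_left_apply, _root_.map_mul, hD,
    AddMonoidAlgebra.coeff_mul_single_apply] at h
  rw [← h]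
  exact Ideal.mul_mem_left _ _ (Ideal.mem_span_singleton_self D)

variable {a : ι → M → ℤ} {I : Ideal (MvPolynomial ι K)} {p : ι → A} {v : K → RInf}

/-- The valuation on `K[x]/I` obtained from a valuation on `A` and a point `p` with values in `A`
whose torus orbit lies in the zero set of `I`, acting with `τ`. -/
def torusVal (hp : ∀ F ∈ I, torusHom a p F = 0) (w : A → RInf) (τ : M → ℝ)
    (f : MvPolynomial ι K ⧸ I) : RInf :=
  gauss w (pairHom τ) (Ideal.Quotient.lift I (torusHom a p).toRingHom hp f)

lemma torusVal_mk (hp : ∀ F ∈ I, torusHom a p F = 0) {w : A → RInf} (h0 : w 0 = ⊤) (τ : M → ℝ)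
    (F : MvPolynomial ι K) :
    torusVal hp w τ (Ideal.Quotient.mk I F) = (F.support.image (wt a)).inf fun β =>
      w (MvPolynomial.aeval p (wtComp a F β)) + (pairR β τ : RInf) := by
  rw [torusVal, Ideal.Quotient.lift_mk]
  change gauss w (pairHom τ) (torusHom a p F) = _
  rw [gauss_eq_inf h0 _ (support_torusHom_subset a p F)]
  simp_rw [coeff_torusHom]
  rfl

lemma torusVal_mk_wtComp (hp : ∀ F ∈ I, torusHom a p F = 0) {w : A → RInf} (h0 : w 0 = ⊤)
    (τ : M → ℝ) (F : MvPolynomial ι K) (β : M → ℤ) :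
    torusVal hp w τ (Ideal.Quotient.mk I (wtComp a F β))
      = w (MvPolynomial.aeval p (wtComp a F β)) + (pairR β τ : RInf) := by
  rw [torusVal, Ideal.Quotient.lift_mk]
  change gauss w (pairHom τ) (torusHom a p _) = _
  rw [torusHom_wtComp, gauss_single h0]
  rfl

lemma torusVal_mem_An (hp : ∀ F ∈ I, torusHom a p F = 0) {w : A → RInf} (hw : w ∈ An v A)
    (τ : M → ℝ) : torusVal hp w τ ∈ An v (MvPolynomial ι K ⧸ I) := by
  refine ⟨(hw.1.gauss (pairHom τ)).comp _, fun c => ?_⟩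
  rw [torusVal, IsScalarTower.algebraMap_apply K (MvPolynomial ι K), Ideal.Quotient.algebraMap_eq,
    Ideal.Quotient.lift_mk]
  change gauss w (pairHom τ) (torusHom a p _) = _
  rw [AlgHom.commutes, AddMonoidAlgebra.coe_algebraMap, Function.comp_apply,
    gauss_single hw.1.map_zero, hw.2]
  simp

lemma tropMap_torusVal (hp : ∀ F ∈ I, torusHom a p F = 0) {w : A → RInf} (hw : w ∈ An v A)
    (τ : M → ℝ) (i : ι) : tropMap I (torusVal hp w τ) i = w (p i) + (pairR (a i) τ : RInf) := by
  rw [tropMap, torusVal, Ideal.Quotient.lift_mk]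
  change gauss w (pairHom τ) (torusHom a p _) = _
  rw [torusHom, MvPolynomial.aeval_X, gauss_single hw.1.map_zero]
  rfl

lemma mu_torusVal (hp : ∀ F ∈ I, torusHom a p F = 0) {w : A → RInf} (h0 : w 0 = ⊤)
    (τ δ : M → ℝ) : mu a I δ (torusVal hp w τ) = torusVal hp w (τ + δ) := by
  funext f
  conv_rhs => rw [← Function.surjInv_eq Ideal.Quotient.mk_surjective f, torusVal_mk hp h0]
  rw [mu, muAux]
  refine Finset.inf_congr rfl fun β _ => ?_
  rw [torusVal_mk_wtComp hp h0, add_assoc, ← WithTop.coe_add, pairR_add]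

lemma torusVal_congr (hp : ∀ F ∈ I, torusHom a p F = 0) {B : Type*} [CommRing B] [Algebra K B]
    {q : ι → B} (hq : ∀ F ∈ I, torusHom a q F = 0)
    {w : A → RInf} (h0 : w 0 = ⊤) {w' : B → RInf} (h0' : w' 0 = ⊤)
    (hw : ∀ F : MvPolynomial ι K, w (MvPolynomial.aeval p F) = w' (MvPolynomial.aeval q F))
    {τ τ' : M → ℝ} (hτ : ∀ i, pairR (a i) τ = pairR (a i) τ') :
    torusVal hp w τ = torusVal hq w' τ' := by
  funext f
  obtain ⟨F, rfl⟩ := Ideal.Quotient.mk_surjective f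
  rw [torusVal_mk hp h0, torusVal_mk hq h0']
  refine Finset.inf_congr rfl fun β hβ => ?_
  obtain ⟨α, -, rfl⟩ := Finset.mem_image.1 hβ
  rw [hw, pairR_wt, pairR_wt]
  simp_rw [hτ]

end Torus

section Cells

/-- A point of the linear space on which every torus orbit in the hyperdeterminantal hypersurface
has a representative. The vertices of the cube are indexed by their parity together with one of
four diagonals. -/
structure IsLPoint {A : Type*} [CommRing A] (p : Bool × Fin 4 → A) : Prop where
  diag_eq : ∀ i j, ∑ b, p (b, i) = ∑ b, p (b, j)
  sum_eq : ∀ b j, ∑ i, p (b, i) = 2 * ∑ b', p (b', j)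

lemma IsLPoint.comp_prodCongr {A : Type*} [CommRing A] {p : Bool × Fin 4 → A} (hp : IsLPoint p)
    (β : Equiv.Perm Bool) (π : Equiv.Perm (Fin 4)) : IsLPoint (p ∘ Equiv.prodCongr β π) where
  diag_eq i j := by
    simpa [-Fintype.univ_bool] using
      (Equiv.sum_comp β fun b => p (b, π i)).trans
        ((hp.diag_eq (π i) (π j)).trans (Equiv.sum_comp β fun b => p (b, π j)).symm)
  sum_eq b j := by
    simpa [-Fintype.univ_bool] using
      (Equiv.sum_comp π fun i => p (β b, i)).trans
        ((hp.sum_eq (β b) (π j)).trans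
          (congrArg (2 * ·) (Equiv.sum_comp β fun b => p (b, π j)).symm))

lemma IsLPoint.sum_mul {A κ : Type*} [CommRing A] [Fintype κ] {n : Bool × Fin 4 → κ → ℤ}
    (hn : ∀ k, IsLPoint fun u => n u k) (q : κ → A) :
    IsLPoint fun u => ∑ k, (n u k : A) * q k where
  diag_eq i j := by
    rw [Finset.sum_comm, Finset.sum_comm (s := Finset.univ (α := Bool))]
    refine Finset.sum_congr rfl fun k _ => ?_
    rw [← Finset.sum_mul, ← Finset.sum_mul, ← Int.cast_sum, ← Int.cast_sum, (hn k).diag_eq i j]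
  sum_eq b j := by
    rw [Finset.sum_comm, Finset.sum_comm (s := Finset.univ (α := Bool)), Finset.mul_sum]
    refine Finset.sum_congr rfl fun k _ => ?_
    rw [← Finset.sum_mul, ← Finset.sum_mul, ← Int.cast_sum, ← Int.cast_sum, (hn k).sum_eq b j]
    push_cast
    ring

/-- Three bases of vertices for the linear space of `IsLPoint`s. -/
def basisVertex : Fin 3 → Fin 4 → Bool × Fin 4 :=
  ![![(false, 0), (true, 1), (true, 2), (true, 3)],
    ![(false, 0), (false, 2), (false, 3), (true, 3)],
    ![(false, 0), (false, 2), (true, 2), (true, 3)]]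

/-- The coordinates of all vertices with respect to the three bases `basisVertex`. -/
def vertexCoord (t : Fin 3) (u : Bool × Fin 4) : Fin 4 → ℤ :=
  cond u.1
    (![![![-2, 1, 1, 1], ![0, 1, 0, 0], ![0, 0, 1, 0], ![0, 0, 0, 1]],
      ![![-1, 0, 1, 1], ![1, 1, 0, -1], ![0, -1, 1, 1], ![0, 0, 0, 1]],
      ![![-1, 1, 1, 0], ![1, 1, 0, -1], ![0, 0, 1, 0], ![0, 0, 0, 1]]] t u.2)
    (![![![1, 0, 0, 0], ![-1, 0, 1, 1], ![-1, 1, 0, 1], ![-1, 1, 1, 0]],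
      ![![1, 0, 0, 0], ![-1, -1, 1, 2], ![0, 1, 0, 0], ![0, 0, 1, 0]],
      ![![1, 0, 0, 0], ![-1, 0, 1, 1], ![0, 1, 0, 0], ![0, 1, 1, -1]]] t u.2)

lemma isLPoint_vertexCoord (t : Fin 3) (k : Fin 4) : IsLPoint fun u => vertexCoord t u k :=
  ⟨by revert t k; decide, by revert t k; decide⟩

lemma IsLPoint.eq_sum {A : Type*} [CommRing A] {p : Bool × Fin 4 → A} (hp : IsLPoint p)
    (t : Fin 3) (u : Bool × Fin 4) :
    p u = ∑ k, (vertexCoord t u k : A) * p (basisVertex t k) := by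
  have h1 := hp.diag_eq 0 1
  have h2 := hp.diag_eq 0 2
  have h3 := hp.diag_eq 0 3
  have h4 := hp.sum_eq false 0
  have h5 := hp.sum_eq true 0
  simp only [Fintype.sum_bool, Fin.sum_univ_four] at h1 h2 h3 h4 h5 ⊢
  obtain ⟨b, i⟩ := u
  fin_cases t <;> fin_cases i <;> cases b <;> simp [vertexCoord, basisVertex] <;> grind

variable {K : Type*} [Field K] {v : K → RInf}

/-- A chart of the linear space: one of the bases, up to the symmetries of the cube. -/
abbrev Chart := Fin 3 × Equiv.Perm (Fin 4) × Equiv.Perm Bool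

/-- The symmetry of the vertices underlying a chart. -/
def Chart.perm (c : Chart) : Equiv.Perm (Bool × Fin 4) := Equiv.prodCongr c.2.2 c.2.1

/-- The basis vertices of a chart. -/
def Chart.basis (c : Chart) (k : Fin 4) : Bool × Fin 4 := c.perm (basisVertex c.1 k)

/-- The parametrisation of the linear space given by a chart. -/
def Chart.form (K : Type*) [Field K] (c : Chart) (u : Bool × Fin 4) : MvPolynomial (Fin 4) K :=
  ∑ k, MvPolynomial.C (vertexCoord c.1 (c.perm.symm u) k : K) * MvPolynomial.X k

lemma Chart.isLPoint_form (c : Chart) : IsLPoint (c.form K) := by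
  have h := (IsLPoint.sum_mul (isLPoint_vertexCoord c.1)
    (MvPolynomial.X : Fin 4 → MvPolynomial (Fin 4) K)).comp_prodCongr c.2.2.symm c.2.1.symm
  convert h using 1
  funext u
  simp [Chart.form, Chart.perm]

lemma IsLPoint.eq_sum_chart {A : Type*} [CommRing A] {p : Bool × Fin 4 → A} (hp : IsLPoint p)
    (c : Chart) (u : Bool × Fin 4) :
    p u = ∑ k, (vertexCoord c.1 (c.perm.symm u) k : A) * p (c.basis k) := by
  have h := (hp.comp_prodCongr c.2.2 c.2.1).eq_sum c.1 (c.perm.symm u)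
  change p (c.perm (c.perm.symm u)) = _ at h
  rwa [Equiv.apply_symm_apply] at h

/-- The valuation on the coordinate ring of the linear space which is the Gauss valuation in
the coordinates of a chart. -/
def Chart.val (v : K → RInf) (c : Chart) (η : Bool × Fin 4 → ℝ) :
    MvPolynomial (Fin 4) K → RInf :=
  mvGauss v (η ∘ c.basis)

/-- The chart `c` realises `η`: the coordinate functions of the vertices have valuation `η`. -/
def Chart.Valid (v : K → RInf) (c : Chart) (η : Bool × Fin 4 → ℝ) : Prop :=
  ∀ u, c.val v η (c.form K u) = (η u : RInf)

lemma Chart.val_mem_An (hv : IsVal v) (c : Chart) (η : Bool × Fin 4 → ℝ) :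
    c.val v η ∈ An v (MvPolynomial (Fin 4) K) :=
  ⟨mvGauss_isVal hv _, mvGauss_C hv _⟩

lemma Chart.val_form (hv : IsVal v) (c : Chart) (η : Bool × Fin 4 → ℝ) (u : Bool × Fin 4) :
    c.val v η (c.form K u) = Finset.univ.inf fun k =>
      v (vertexCoord c.1 (c.perm.symm u) k : K) + (η (c.basis k) : RInf) :=
  mvGauss_linear hv _ _

lemma Chart.val_aeval_le (hv : IsVal v) {c c' : Chart} {η : Bool × Fin 4 → ℝ}
    (h : c'.Valid v η) {ι : Type*} (g : ι → Bool × Fin 4) (P : MvPolynomial ι K) :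
    c.val v η (MvPolynomial.aeval (c.form K ∘ g) P)
      ≤ c'.val v η (MvPolynomial.aeval (c'.form K ∘ g) P) := by
  let θ : MvPolynomial (Fin 4) K →ₐ[K] MvPolynomial (Fin 4) K :=
    MvPolynomial.aeval (c'.form K ∘ c.basis)
  have hθ : θ (MvPolynomial.aeval (c.form K ∘ g) P) = MvPolynomial.aeval (c'.form K ∘ g) P := by
    rw [← AlgHom.comp_apply]
    congr 1
    refine MvPolynomial.algHom_ext fun i => ?_
    simp only [AlgHom.comp_apply, MvPolynomial.aeval_X, Function.comp_apply]
    rw [(c'.isLPoint_form (K := K)).eq_sum_chart c (g i), Chart.form, map_sum]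
    simp [θ]
  rw [← hθ]
  refine mvGauss_le_map hv (c'.val_mem_An hv η) θ (fun k => ?_) _
  simp only [θ, MvPolynomial.aeval_X, Function.comp_apply]
  exact (h _).ge

lemma Chart.val_aeval_eq (hv : IsVal v) {c c' : Chart} {η : Bool × Fin 4 → ℝ}
    (h : c.Valid v η) (h' : c'.Valid v η) {ι : Type*} (g : ι → Bool × Fin 4)
    (P : MvPolynomial ι K) :
    c.val v η (MvPolynomial.aeval (c.form K ∘ g) P)
      = c'.val v η (MvPolynomial.aeval (c'.form K ∘ g) P) :=
  le_antisymm (Chart.val_aeval_le hv h' g P) (Chart.val_aeval_le hv h g P)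

end Cells

section Coverage

variable {K : Type*} [Field K] {v : K → RInf}

lemma Chart.valid_iff (hv : IsVal v) (c : Chart) (η : Bool × Fin 4 → ℝ) :
    c.Valid v η ↔ ∀ u, (Finset.univ.inf fun k =>
      v (vertexCoord c.1 u k : K) + (η (c.perm (basisVertex c.1 k)) : RInf))
        = (η (c.perm u) : RInf) := by
  rw [Chart.Valid, c.perm.surjective.forall]
  simp_rw [Chart.val_form hv, Equiv.symm_apply_apply]
  rfl

lemma exists_valid_of_comp (hv : IsVal v) {η : Bool × Fin 4 → ℝ} (β : Equiv.Perm Bool)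
    (π : Equiv.Perm (Fin 4)) (h : ∃ c : Chart, c.Valid v (η ∘ Equiv.prodCongr β π)) :
    ∃ c : Chart, c.Valid v η := by
  obtain ⟨c, hc⟩ := h
  refine ⟨(c.1, c.2.1.trans π, c.2.2.trans β), ?_⟩
  rw [Chart.valid_iff hv] at hc ⊢
  exact hc

lemma exists_valid_of_forall (hv : IsVal v) {η : Bool × Fin 4 → ℝ} (t : Fin 3)
    (h : ∀ u, (v (vertexCoord t u 0 : K) + (η (basisVertex t 0) : RInf)) ⊓
      ((v (vertexCoord t u 1 : K) + (η (basisVertex t 1) : RInf)) ⊓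
      ((v (vertexCoord t u 2 : K) + (η (basisVertex t 2) : RInf)) ⊓
      (v (vertexCoord t u 3 : K) + (η (basisVertex t 3) : RInf)))) = (η u : RInf)) :
    ∃ c : Chart, c.Valid v η := by
  refine ⟨(t, 1, 1), (Chart.valid_iff hv _ _).2 fun u => ?_⟩
  rw [show (Finset.univ : Finset (Fin 4)) = {0, 1, 2, 3} from rfl]
  simpa [Chart.perm] using h u

lemma exists_valid_of_const (hv : IsVal v) {η : Bool × Fin 4 → ℝ}
    (he : ∀ i, η (false, i) = η (false, 0)) (ho : ∀ i, η (false, 0) ≤ η (true, i))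
    (h0 : ∀ i, η (true, 0) ≤ η (true, i)) (h2 : (η (true, 0) : RInf) ≤ v 2 + η (false, 0))
    (heq : v 2 + η (false, 0) = (η (true, 0) : RInf) ∨ η (true, 1) = η (true, 0)) :
    ∃ c : Chart, c.Valid v η := by
  refine exists_valid_of_forall hv 0 ?_
  have h01 := h0 1
  have h02 := h0 2
  have h03 := h0 3
  have ho1 := ho 1
  have ho2 := ho 2
  have ho3 := ho 3
  have he1 := he 1
  have he2 := he 2
  have he3 := he 3
  rintro ⟨b, i⟩
  fin_cases i <;> cases b <;>
    simp [vertexCoord, basisVertex, hv.map_zero, hv.map_one, hv.map_neg, *]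
  rcases heq with heq | heq
  · simp [*]
  · simp [*]

lemma exists_valid_of_le (hv : IsVal v) {η : Bool × Fin 4 → ℝ} {r κ : ℝ}
    (he0 : η (false, 0) = r) (he1 : η (false, 1) = r) (ho0 : η (true, 0) = r)
    (ho1 : η (true, 1) = r) (hr : r ≤ κ) (ho2 : η (true, 2) = κ) (ho3 : η (true, 3) = κ)
    (he2 : κ ≤ η (false, 2)) (he3 : κ ≤ η (false, 3)) :
    ∃ c : Chart, c.Valid v η := by
  refine exists_valid_of_forall hv 1 ?_
  have h2 := hv.two_nonneg
  have h3 : (r : RInf) ≤ v 2 + κ := by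
    simpa using add_le_add h2 (WithTop.coe_le_coe.2 hr)
  have h4 := hr.trans he2
  have h5 := hr.trans he3
  rintro ⟨b, i⟩
  fin_cases i <;> cases b <;>
    simp [vertexCoord, basisVertex, hv.map_zero, hv.map_one, hv.map_neg, *]

lemma exists_valid_of_le' (hv : IsVal v) {η : Bool × Fin 4 → ℝ} {r κ : ℝ}
    (he0 : η (false, 0) = r) (he1 : η (false, 1) = r) (ho0 : η (true, 0) = r)
    (ho1 : η (true, 1) = r) (hr : r ≤ κ) (ho3 : η (true, 3) = κ) (he3 : η (false, 3) = κ)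
    (he2 : κ ≤ η (false, 2)) (ho2 : κ ≤ η (true, 2)) :
    ∃ c : Chart, c.Valid v η := by
  refine exists_valid_of_forall hv 2 ?_
  have h4 := hr.trans he2
  have h5 := hr.trans ho2
  rintro ⟨b, i⟩
  fin_cases i <;> cases b <;>
    simp [vertexCoord, basisVertex, hv.map_zero, hv.map_one, hv.map_neg, *]

/-- The normalisation which singles out one point in each orbit of the torus. -/
def Normalized (η : Bool × Fin 4 → ℝ) : Prop :=
  ∀ π : Equiv.Perm (Fin 4),
    min (η (false, π 0) + η (false, π 1)) (η (true, π 2) + η (true, π 3))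
      = min (η (false, π 2) + η (false, π 3)) (η (true, π 0) + η (true, π 1))

lemma perm_bool_eq : ∀ β : Equiv.Perm Bool, β = 1 ∨ β = Equiv.swap false true := by decide

lemma exists_perm_apply_eq :
    ∀ i j : Fin 4, i ≠ j → ∃ π : Equiv.Perm (Fin 4), π 0 = i ∧ π 1 = j := by decide

lemma Normalized.comp {η : Bool × Fin 4 → ℝ} (h : Normalized η) (β : Equiv.Perm Bool)
    (π : Equiv.Perm (Fin 4)) : Normalized (η ∘ Equiv.prodCongr β π) := by
  intro τ
  have h1 := h (τ.trans π)
  rcases perm_bool_eq β with rfl | rfl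
  · simpa using h1
  · simp only [Equiv.trans_apply] at h1
    simp only [Function.comp_apply, Equiv.prodCongr_apply, Prod.map, Equiv.swap_apply_left,
      Equiv.swap_apply_right]
    rw [min_comm, ← h1, min_comm]

lemma Normalized.splittings {η : Bool × Fin 4 → ℝ} (h : Normalized η) :
    min (η (false, 0) + η (false, 1)) (η (true, 2) + η (true, 3))
      = min (η (false, 2) + η (false, 3)) (η (true, 0) + η (true, 1)) ∧
    min (η (false, 0) + η (false, 2)) (η (true, 1) + η (true, 3))
      = min (η (false, 1) + η (false, 3)) (η (true, 0) + η (true, 2)) ∧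
    min (η (false, 0) + η (false, 3)) (η (true, 1) + η (true, 2))
      = min (η (false, 1) + η (false, 2)) (η (true, 0) + η (true, 3)) := by
  refine ⟨h 1, h (Equiv.swap 1 2), ?_⟩
  rw [add_comm (η (true, 1)), add_comm (η (false, 1))]
  exact h (Equiv.swap 1 3)

/-- The sum of the values of `η` at two antipodal vertices. -/
def diagSum (η : Bool × Fin 4 → ℝ) (i : Fin 4) : ℝ := η (false, i) + η (true, i)

/-- The sum of the values of `η` at the vertices of given parity. -/
def paritySum (η : Bool × Fin 4 → ℝ) (b : Bool) : ℝ := ∑ i, η (b, i)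

/-- The tropical hyperdeterminant, whose coefficients `2` and `4` have values `V` and
`2 V`, vanishes at `η`. -/
def TropVanish (V : RInf) (η : Bool × Fin 4 → ℝ) : Prop :=
  (∃ i j, i ≠ j ∧ diagSum η i = diagSum η j ∧ (∀ k, diagSum η i ≤ diagSum η k) ∧
    ∀ b, ((2 * diagSum η i : ℝ) : RInf) ≤ V + V + (paritySum η b : RInf)) ∨
  ∃ i b, ∃ ε : ℝ, V = ε ∧ 2 * diagSum η i = 2 * ε + paritySum η b ∧
    ∀ k, diagSum η i ≤ diagSum η k

lemma eq_of_min_eq_min {a b c d : ℝ} (h : min a d = min b c) (h1 : a + b ≤ a + c)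
    (h2 : a + b ≤ b + d) : a = b := by
  rcases le_total a d with h4 | h4 <;> rcases le_total b c with h5 | h5 <;>
    simp only [min_eq_left, min_eq_right, h4, h5] at h <;> linarith

lemma Normalized.eq_of_paritySum_le {η : Bool × Fin 4 → ℝ} (hN : Normalized η)
    (h : ∀ k, paritySum η false ≤ 2 * diagSum η k) (i : Fin 4) :
    η (false, i) = η (false, 0) := by
  obtain ⟨n1, n2, n3⟩ := hN.splittings
  have d0 := h 0
  have d1 := h 1
  have d2 := h 2
  have d3 := h 3
  simp only [paritySum, diagSum, Fin.sum_univ_four] at d0 d1 d2 d3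
  have e1 := eq_of_min_eq_min n1
  have e2 := eq_of_min_eq_min n2
  have e3 := eq_of_min_eq_min n3
  have e1 := e1 (by linarith) (by linarith)
  have e2 := e2 (by linarith) (by linarith)
  have e3 := e3 (by linarith) (by linarith)
  fin_cases i <;> simp only [Fin.zero_eta, Fin.mk_one, Fin.reduceFinMk] <;> linarith

lemma exists_valid_of_two_mul_diagSum_eq (hv : IsVal v) {η : Bool × Fin 4 → ℝ}
    (hN : Normalized η) {ε : ℝ} (hε : v 2 = ε)
    (h0 : 2 * diagSum η 0 = 2 * ε + paritySum η false)
    (h : ∀ k, diagSum η 0 ≤ diagSum η k) :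
    ∃ c : Chart, c.Valid v η := by
  have h2 := hv.two_nonneg
  rw [hε, ← WithTop.coe_zero, WithTop.coe_le_coe] at h2
  have he := hN.eq_of_paritySum_le fun k => by linarith [h k]
  have ho : ∀ i, η (true, 0) ≤ η (true, i) := fun i => by
    have := h i
    rw [diagSum, diagSum, he i] at this
    linarith
  simp only [paritySum, diagSum, Fin.sum_univ_four, he] at h0
  have hs : ε + η (false, 0) = η (true, 0) := by linarith
  have hs' : v 2 + η (false, 0) = (η (true, 0) : RInf) := by
    rw [hε, ← hs, WithTop.coe_add]
  exact exists_valid_of_const hv he (fun i => by linarith [ho i]) ho hs'.ge (Or.inl hs')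

lemma exists_valid_of_paritySum_lt (hv : IsVal v) {η : Bool × Fin 4 → ℝ} (hN : Normalized η)
    (h01 : diagSum η 0 = diagSum η 1) (h : ∀ k, diagSum η 0 ≤ diagSum η k)
    (h2 : ((2 * diagSum η 0 : ℝ) : RInf) ≤ v 2 + v 2 + (paritySum η false : RInf))
    (hlt : paritySum η false ≤ 2 * diagSum η 0) : ∃ c : Chart, c.Valid v η := by
  have he := hN.eq_of_paritySum_le fun k => by linarith [h k]
  have ho : ∀ i, η (true, 0) ≤ η (true, i) := fun i => by
    have := h i
    rw [diagSum, diagSum, he i] at this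
    linarith
  simp only [paritySum, diagSum, Fin.sum_univ_four, he] at hlt h2 h01
  refine exists_valid_of_const hv he (fun i => by linarith [ho i]) ho ?_ (Or.inr (by linarith))
  induction hV : v 2 using WithTop.recTopCoe with
  | top => simp
  | coe ε =>
    rw [hV] at h2
    norm_cast at h2 ⊢
    linarith

lemma eq_of_three_min_eq_min {e₀ e₁ e₂ e₃ o₀ o₁ o₂ o₃ : ℝ}
    (n₁ : min (e₀ + e₁) (o₂ + o₃) = min (e₂ + e₃) (o₀ + o₁))
    (n₂ : min (e₀ + e₂) (o₁ + o₃) = min (e₁ + e₃) (o₀ + o₂))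
    (n₃ : min (e₀ + e₃) (o₁ + o₂) = min (e₁ + e₂) (o₀ + o₃))
    (h₁ : e₀ + o₀ = e₁ + o₁) (h₂ : e₀ + o₀ ≤ e₂ + o₂) (h₃ : e₀ + o₀ ≤ e₃ + o₃)
    (he : 2 * (e₀ + o₀) ≤ e₀ + e₁ + e₂ + e₃) (ho : 2 * (e₀ + o₀) ≤ o₀ + o₁ + o₂ + o₃) :
    e₁ = e₀ ∧ o₀ = e₀ ∧ o₁ = e₀ ∧ min e₂ o₃ = min e₃ o₂ ∧ e₀ ≤ min e₂ o₃ := by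
  have h : e₀ + e₁ = o₀ + o₁ := by
    rcases le_total (e₀ + e₁) (o₂ + o₃) with h4 | h4 <;>
      rcases le_total (e₂ + e₃) (o₀ + o₁) with h5 | h5 <;>
      simp only [min_eq_left, min_eq_right, h4, h5] at n₁ <;> linarith
  obtain rfl : o₀ = e₁ := by linarith
  obtain rfl : o₁ = e₀ := by linarith
  rw [min_add_add_left, min_add_add_left] at n₂ n₃
  rw [min_comm e₃, min_comm e₂] at n₃
  have hκ : min e₂ o₃ = min e₃ o₂ := by
    rw [min_comm o₃, min_comm o₂] at n₃
    linarith
  have h0 : o₀ = o₁ := by linarith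
  subst h0
  refine ⟨rfl, rfl, rfl, hκ, ?_⟩
  rcases le_total e₂ o₃ with h4 | h4 <;> rcases le_total e₃ o₂ with h5 | h5 <;>
    simp only [min_eq_left, min_eq_right, h4, h5] at hκ ⊢ <;> linarith

lemma exists_valid_of_diagSum_eq (hv : IsVal v) {η : Bool × Fin 4 → ℝ} (hN : Normalized η)
    (h01 : diagSum η 0 = diagSum η 1) (h : ∀ k, diagSum η 0 ≤ diagSum η k)
    (h2 : ∀ b, ((2 * diagSum η 0 : ℝ) : RInf) ≤ v 2 + v 2 + (paritySum η b : RInf)) :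
    ∃ c : Chart, c.Valid v η := by
  rcases le_total (paritySum η false) (2 * diagSum η 0) with hF | hF
  · exact exists_valid_of_paritySum_lt hv hN h01 h (h2 false) hF
  have hd : ∀ k, diagSum (η ∘ Equiv.prodCongr (Equiv.swap false true) 1) k = diagSum η k :=
    fun k => by simp [diagSum, add_comm]
  have hp : paritySum (η ∘ Equiv.prodCongr (Equiv.swap false true) 1) false = paritySum η true := by
    simp [paritySum]
  rcases le_total (paritySum η true) (2 * diagSum η 0) with hT | hT
  · refine exists_valid_of_comp hv (Equiv.swap false true) 1
      (exists_valid_of_paritySum_lt hv (hN.comp _ _) ?_ ?_ ?_ ?_)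
    · rwa [hd, hd]
    · simpa only [hd] using h
    · rw [hd, hp]
      exact h2 true
    · rwa [hd, hp]
  clear h2 hd hp
  obtain ⟨n1, n2, n3⟩ := hN.splittings
  have d2 := h 2
  have d3 := h 3
  simp only [paritySum, diagSum, Fin.sum_univ_four] at hF hT d2 d3 h01
  obtain ⟨f1, t0, t1, hκ, hr⟩ := eq_of_three_min_eq_min n1 n2 n3 h01 d2 d3
    (by linarith) (by linarith)
  rcases le_total (η (false, 2)) (η (true, 3)) with h4 | h4 <;>
    rcases le_total (η (false, 3)) (η (true, 2)) with h5 | h5 <;>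
    simp only [min_eq_left, min_eq_right, h4, h5] at hκ hr
  · refine exists_valid_of_comp hv (Equiv.swap false true) 1 (exists_valid_of_le hv
      (r := η (false, 0)) (κ := η (false, 2)) ?_ ?_ ?_ ?_ hr ?_ ?_ ?_ ?_) <;> simp <;> linarith
  · refine exists_valid_of_comp hv 1 (Equiv.swap 2 3) (exists_valid_of_le' hv
      (r := η (false, 0)) (κ := η (false, 2)) ?_ ?_ ?_ ?_ hr ?_ ?_ ?_ ?_) <;>
      simp [Equiv.swap_apply_of_ne_of_ne] <;> linarith
  · exact exists_valid_of_le' hv rfl f1 t0 t1 hr rfl hκ.symm h4 (by linarith)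
  · exact exists_valid_of_le hv rfl f1 t0 t1 hr hκ.symm rfl h4 (by linarith)

lemma exists_valid_of_tropVanish (hv : IsVal v) {η : Bool × Fin 4 → ℝ} (hN : Normalized η)
    (h : TropVanish (v 2) η) : ∃ c : Chart, c.Valid v η := by
  rcases h with ⟨i, j, hij, h1, h2, h3⟩ | ⟨i, b, ε, hε, h1, h2⟩
  · obtain ⟨π, rfl, rfl⟩ := exists_perm_apply_eq i j hij
    have hp : ∀ b, paritySum (η ∘ Equiv.prodCongr 1 π) b = paritySum η b :=
      fun b => Equiv.sum_comp π fun i => η (b, i)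
    refine exists_valid_of_comp hv 1 π (exists_valid_of_diagSum_eq hv (hN.comp _ _) h1
      (fun k => h2 (π k)) fun b => ?_)
    rw [hp]
    exact h3 b
  · obtain ⟨π, rfl⟩ : ∃ π : Equiv.Perm (Fin 4), π 0 = i := ⟨Equiv.swap 0 i, by simp⟩
    obtain ⟨β, rfl⟩ : ∃ β : Equiv.Perm Bool, β false = b := ⟨Equiv.swap false b, by simp⟩
    have hd : ∀ k, diagSum (η ∘ Equiv.prodCongr β π) k = diagSum η (π k) := fun k => by
      rcases perm_bool_eq β with rfl | rfl
      · rfl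
      · simp [diagSum, add_comm]
    have hp : paritySum (η ∘ Equiv.prodCongr β π) false = paritySum η (β false) :=
      Equiv.sum_comp π fun i => η (β false, i)
    refine exists_valid_of_comp hv β π (exists_valid_of_two_mul_diagSum_eq hv (hN.comp _ _) hε ?_
      fun k => ?_)
    · rw [hd, hp, h1]
    · rw [hd, hd]
      exact h2 _

end Coverage

section Tropical

lemma tropVanish_of_sum_eq_zero {B : Type*} [CommRing B] {w : B → RInf} (hw : IsVal w)
    {x : Bool × Fin 4 → B} {η : Bool × Fin 4 → ℝ} (hx : ∀ u, w (x u) = η u)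
    (h : ∑ i, (x (false, i) * x (true, i)) ^ 2 + ∑ b, 2 * 2 * ∏ i, x (b, i)
      + ∑ p : Fin 4 × Fin 4, (if p.1 < p.2 then
        -(2 * ((x (false, p.1) * x (true, p.1)) * (x (false, p.2) * x (true, p.2)))) else 0) = 0) :
    TropVanish (w 2) η := by
  set s : Fin 4 ⊕ Bool → B := Sum.elim (fun i => (x (false, i) * x (true, i)) ^ 2)
    fun b => 2 * 2 * ∏ i, x (b, i) with hs
  set t : Fin 4 × Fin 4 → B := fun p => if p.1 < p.2 then
    -(2 * ((x (false, p.1) * x (true, p.1)) * (x (false, p.2) * x (true, p.2)))) else 0 with ht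
  have hsum : ∑ n, Sum.elim s t n = 0 := by
    simpa only [Fintype.sum_sum_type, Sum.elim_inl, Sum.elim_inr, hs, ht] using h
  have hY : ∀ i, w (s (Sum.inl i)) = ((2 * diagSum η i : ℝ) : RInf) := fun i => by
    simp only [hs, Sum.elim_inl, hw.map_pow, hw.map_mul, hx, diagSum]
    norm_cast
    rw [nsmul_eq_mul, Nat.cast_ofNat]
  have hB : ∀ b, w (s (Sum.inr b)) = w 2 + w 2 + (paritySum η b : RInf) := fun b => by
    simp only [hs, Sum.elim_inr, hw.map_mul, hw.map_prod, hx, paritySum, WithTop.coe_sum]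
  have hP : ∀ p : Fin 4 × Fin 4, p.1 < p.2 →
      w (t p) = w 2 + ((diagSum η p.1 + diagSum η p.2 : ℝ) : RInf) := fun p hp => by
    simp only [ht, if_pos hp, hw.map_neg, hw.map_mul, hx, diagSum, WithTop.coe_add]
  have h2 := hw.two_nonneg
  obtain ⟨m, -, hm⟩ := Finset.exists_min_image Finset.univ (fun n => w (s n))
    Finset.univ_nonempty
  replace hm := fun n => hm n (Finset.mem_univ n)
  have hfin : w (s m) < ⊤ := (hm (Sum.inl 0)).trans_lt (by rw [hY]; exact WithTop.coe_lt_top _)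
  obtain ⟨n, hne, hn⟩ := hw.exists_ne_le_of_sum_eq_zero _ hsum (Sum.inl m) hfin
  have hmY := fun i => hm (Sum.inl i)
  have hmB := fun b => hm (Sum.inr b)
  simp only [hY, hB] at hmY hmB
  have hsumd : diagSum η 0 + diagSum η 1 + diagSum η 2 + diagSum η 3
      = paritySum η false + paritySum η true := by
    simp only [diagSum, paritySum, Fin.sum_univ_four]
    ring
  generalize w 2 = V at *
  rcases m with i | b
  · rw [hY] at hmB
    simp only [hY, WithTop.coe_le_coe] at hmY
    rcases n with (j | b) | p
    · simp only [Sum.elim_inl, hY, WithTop.coe_le_coe] at hn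
      exact Or.inl ⟨i, j, fun hij => hne (by rw [hij]), by linarith [hmY j],
        fun k => by linarith [hmY k], hmB⟩
    · have heq := le_antisymm (hmB b) (by simpa only [Sum.elim_inl, hY, hB] using hn)
      induction V using WithTop.recTopCoe with
      | top => simp only [top_add, WithTop.coe_ne_top] at heq
      | coe ε =>
        norm_cast at heq
        exact Or.inr ⟨i, b, ε, rfl, by linarith, fun k => by linarith [hmY k]⟩
    · have hp : p.1 < p.2 := by
        by_contra hp
        simp only [Sum.elim_inr, Sum.elim_inl, ht, if_neg hp, hw.map_zero, hY, top_le_iff,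
          WithTop.coe_ne_top] at hn
      have hle : ((diagSum η p.1 + diagSum η p.2 : ℝ) : RInf) ≤ ((2 * diagSum η i : ℝ) : RInf) := by
        rw [← hY i]
        refine le_trans ?_ hn
        rw [Sum.elim_inr, hP p hp]
        exact le_add_of_nonneg_left h2
      rw [WithTop.coe_le_coe] at hle
      have e1 : diagSum η p.1 = diagSum η i := by linarith [hmY p.1, hmY p.2]
      have e2 : diagSum η p.2 = diagSum η i := by linarith [hmY p.1, hmY p.2]
      refine Or.inl ⟨p.1, p.2, hp.ne, by rw [e1, e2], fun k => ?_, ?_⟩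
      · linarith [hmY k]
      · rwa [e1]
  · rw [hB] at hmB
    simp only [hB] at hmY
    simp only [Sum.elim_inl, hB] at hn
    induction V using WithTop.recTopCoe with
    | top =>
      have := hmY 0
      simp only [top_add, top_le_iff, WithTop.coe_ne_top] at this
    | coe ε =>
      norm_cast at hmY hmB h2
      rcases n with (i | b') | p
      · simp only [Sum.elim_inl, hY] at hn
        norm_cast at hn
        exact Or.inr ⟨i, b, ε, rfl, by linarith [hmY i], fun k => by linarith [hmY k]⟩
      · simp only [Sum.elim_inl, hB] at hn
        norm_cast at hn
        have := hmY 0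
        have := hmY 1
        have := hmY 2
        have := hmY 3
        have : ∀ k, 2 * diagSum η k = ε + ε + paritySum η b := by
          cases b <;> cases b' <;> simp [Fin.forall_fin_succ] at hne ⊢ <;>
            refine ⟨?_, ?_, ?_, ?_⟩ <;> linarith
        exact Or.inr ⟨0, b, ε, rfl, by linarith [this 0], fun k => by linarith [this k, this 0]⟩
      · have hp : p.1 < p.2 := by
          by_contra hp
          simp only [Sum.elim_inr, ht, if_neg hp, hw.map_zero] at hn
          norm_cast at hn
        simp only [Sum.elim_inr, hP p hp] at hn
        norm_cast at hn
        exact Or.inr ⟨p.1, b, ε, rfl, by linarith [hmY p.1, hmY p.2],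
          fun k => by linarith [hmY k, hmY p.1, hmY p.2]⟩

lemma TropVanish.of_sub {V : RInf} {η η' : Bool × Fin 4 → ℝ} (h : TropVanish V η) (T : ℝ)
    (hd : ∀ i, diagSum η' i = diagSum η i - T) (hp : ∀ b, paritySum η' b = paritySum η b - 2 * T) :
    TropVanish V η' := by
  rcases h with ⟨i, j, hij, h1, h2, h3⟩ | ⟨i, b, ε, hε, h1, h2⟩
  · refine Or.inl ⟨i, j, hij, by rw [hd, hd, h1], fun k => ?_, fun b => ?_⟩
    · rw [hd, hd]
      linarith [h2 k]
    · have h4 := h3 b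
      rw [hd, hp]
      induction V using WithTop.recTopCoe with
      | top => simp
      | coe ε =>
        norm_cast at h4 ⊢
        linarith
  · refine Or.inr ⟨i, b, ε, hε, by rw [hd, hp]; linarith, fun k => ?_⟩
    rw [hd, hd]
    linarith [h2 k]

lemma normalized_of_splittings {η : Bool × Fin 4 → ℝ}
    (h1 : min (η (false, 0) + η (false, 1)) (η (true, 2) + η (true, 3))
      = min (η (false, 2) + η (false, 3)) (η (true, 0) + η (true, 1)))
    (h2 : min (η (false, 0) + η (false, 2)) (η (true, 1) + η (true, 3))
      = min (η (false, 1) + η (false, 3)) (η (true, 0) + η (true, 2)))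
    (h3 : min (η (false, 0) + η (false, 3)) (η (true, 1) + η (true, 2))
      = min (η (false, 1) + η (false, 2)) (η (true, 0) + η (true, 3))) : Normalized η := by
  intro π
  have n01 : π 0 ≠ π 1 := by simp
  have n02 : π 0 ≠ π 2 := by simp
  have n03 : π 0 ≠ π 3 := by simp
  have n12 : π 1 ≠ π 2 := by simp
  have n13 : π 1 ≠ π 3 := by simp
  have n23 : π 2 ≠ π 3 := by simp
  generalize π 0 = i at *
  generalize π 1 = j at *
  generalize π 2 = k at *
  generalize π 3 = l at *
  fin_cases i <;> fin_cases j <;> (try exact absurd rfl n01) <;> fin_cases k <;>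
    (try exact absurd rfl n02) <;> (try exact absurd rfl n12) <;> fin_cases l <;>
    (try exact absurd rfl n03) <;> (try exact absurd rfl n13) <;> (try exact absurd rfl n23) <;>
    simp only [Fin.zero_eta, Fin.mk_one, Fin.reduceFinMk] <;> grind

end Tropical

section Hyperdeterminant

variable {K : Type*} [Field K]

lemma aeval_cayley_mul {A : Type*} [CommRing A] [Algebra K A] (α β γ : Fin 2 → A)
    (q : Fin 2 × Fin 2 × Fin 2 → A) :
    MvPolynomial.aeval (fun u => α u.1 * β u.2.1 * γ u.2.2 * q u) (cayley K)
      = (α 0 * α 1 * β 0 * β 1 * γ 0 * γ 1) ^ 2 * MvPolynomial.aeval q (cayley K) := by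
  simp only [cayley, map_add, map_sub, map_mul, map_pow, map_ofNat, MvPolynomial.aeval_X]
  ring

lemma torusHom_cayley {A : Type*} [CommRing A] [Algebra K A] (q : Fin 2 × Fin 2 × Fin 2 → A) :
    torusHom cayleyWt q (cayley K)
      = AddMonoidAlgebra.single (fun _ => 2) (MvPolynomial.aeval q (cayley K)) := by
  have hS : ∀ P, AddMonoidAlgebra.single 0 (MvPolynomial.aeval q P)
      = MvPolynomial.aeval (fun u => (AddMonoidAlgebra.single 0 (q u) :
        AddMonoidAlgebra A ((Fin 2 ⊕ Fin 2 ⊕ Fin 2) → ℤ))) (P : MvPolynomial _ K) := by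
    intro P
    have := MvPolynomial.comp_aeval_apply (R := K) q
      (AddMonoidAlgebra.singleZeroAlgHom (R := K) (A := A) (M := (Fin 2 ⊕ Fin 2 ⊕ Fin 2) → ℤ)) P
    exact this
  set e₁ : Fin 2 → (Fin 2 ⊕ Fin 2 ⊕ Fin 2) → ℤ := fun i => Pi.single (Sum.inl i) 1 with he₁
  set e₂ : Fin 2 → (Fin 2 ⊕ Fin 2 ⊕ Fin 2) → ℤ := fun j => Pi.single (Sum.inr (Sum.inl j)) 1
    with he₂
  set e₃ : Fin 2 → (Fin 2 ⊕ Fin 2 ⊕ Fin 2) → ℤ := fun k => Pi.single (Sum.inr (Sum.inr k)) 1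
    with he₃
  have hfac : ∀ u, (AddMonoidAlgebra.single (cayleyWt u) (q u) :
      AddMonoidAlgebra A ((Fin 2 ⊕ Fin 2 ⊕ Fin 2) → ℤ))
      = AddMonoidAlgebra.single (e₁ u.1) 1 * AddMonoidAlgebra.single (e₂ u.2.1) 1
        * AddMonoidAlgebra.single (e₃ u.2.2) 1 * AddMonoidAlgebra.single 0 (q u) := by
    intro u
    simp only [AddMonoidAlgebra.single_mul_single, one_mul]
    congr 1
    funext s
    rcases s with s | s | s <;> simp [cayleyWt, he₁, he₂, he₃, Pi.single_apply]
  rw [torusHom]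
  simp_rw [hfac]
  rw [aeval_cayley_mul (fun i => AddMonoidAlgebra.single (e₁ i) 1)
    (fun j => AddMonoidAlgebra.single (e₂ j) 1) (fun k => AddMonoidAlgebra.single (e₃ k) 1), ← hS]
  simp only [AddMonoidAlgebra.single_mul_single, AddMonoidAlgebra.single_pow, one_mul, one_pow]
  congr 1
  funext s
  rcases s with s | s | s <;> fin_cases s <;> simp [he₁, he₂, he₃]

/-- The vertices of the cube, indexed by parity and diagonal. -/
def vertexEquiv : Fin 2 × Fin 2 × Fin 2 ≃ Bool × Fin 4 where
  toFun u := ![![![(false, 0), (true, 3)], ![(true, 2), (false, 1)]],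
    ![![(true, 1), (false, 2)], ![(false, 3), (true, 0)]]] u.1 u.2.1 u.2.2
  invFun d := cond d.1 (![(1, 1, 1), (1, 0, 0), (0, 1, 0), (0, 0, 1)] d.2)
    (![(0, 0, 0), (0, 1, 1), (1, 0, 1), (1, 1, 0)] d.2)
  left_inv := by decide
  right_inv := by decide

lemma IsLPoint.aeval_cayley {A : Type*} [CommRing A] [Algebra K A] {q : Bool × Fin 4 → A}
    (hq : IsLPoint q) : MvPolynomial.aeval (q ∘ vertexEquiv) (cayley K) = 0 := by
  have h := hq.eq_sum 0
  have h0 := h (true, 0)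
  have h1 := h (false, 1)
  have h2 := h (false, 2)
  have h3 := h (false, 3)
  simp [Fin.sum_univ_four, vertexCoord, basisVertex] at h0 h1 h2 h3
  simp only [cayley, map_add, map_sub, map_mul, map_pow, map_ofNat, MvPolynomial.aeval_X,
    Function.comp_apply]
  simp only [vertexEquiv, Equiv.coe_fn_mk, Matrix.cons_val_zero, Matrix.cons_val_one, h0, h1, h2, h3]
  ring

lemma aeval_cayley_eq_sum {A : Type*} [CommRing A] [Algebra K A] (x : Bool × Fin 4 → A) :
    MvPolynomial.aeval (x ∘ vertexEquiv) (cayley K)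
      = ∑ i, (x (false, i) * x (true, i)) ^ 2 + ∑ b, 2 * 2 * ∏ i, x (b, i)
        + ∑ p : Fin 4 × Fin 4, (if p.1 < p.2 then
          -(2 * ((x (false, p.1) * x (true, p.1)) * (x (false, p.2) * x (true, p.2)))) else 0) := by
  simp only [cayley, map_add, map_sub, map_mul, map_pow, map_ofNat, MvPolynomial.aeval_X,
    Function.comp_apply, Fintype.sum_prod_type, Fin.sum_univ_four, Fintype.sum_bool,
    Fin.prod_univ_four, vertexEquiv, Equiv.coe_fn_mk, Matrix.cons_val_zero, Matrix.cons_val_one,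
    Fin.reduceLT, if_true, if_false]
  ring

lemma tropVanish_of_mem_tropSet0 {v : K → RInf} {ξ : Fin 2 × Fin 2 × Fin 2 → ℝ}
    (hξ : ξ ∈ TropSet0 v (Ideal.span {cayley K})) : TropVanish (v 2) (ξ ∘ vertexEquiv.symm) := by
  obtain ⟨w, ⟨hw, hwv⟩, hwξ⟩ := hξ
  have h2 : w 2 = v 2 := by rw [← hwv 2, map_ofNat]
  rw [← h2]
  obtain ⟨x, hx⟩ : ∃ x : Bool × Fin 4 → MvPolynomial (Fin 2 × Fin 2 × Fin 2) K ⧸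
      Ideal.span {cayley K}, ∀ d, x d = Ideal.Quotient.mk _ (MvPolynomial.X (vertexEquiv.symm d)) :=
    ⟨_, fun _ => rfl⟩
  have h0 : MvPolynomial.aeval (x ∘ vertexEquiv) (cayley K) = 0 := by
    have hX : x ∘ vertexEquiv
        = fun u => Ideal.Quotient.mkₐ K (Ideal.span {cayley K}) (MvPolynomial.X u) := by
      funext u
      rw [Function.comp_apply, hx, Equiv.symm_apply_apply, Ideal.Quotient.mkₐ_eq_mk]
    rw [hX, ← MvPolynomial.comp_aeval_apply, MvPolynomial.aeval_X_left_apply,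
      Ideal.Quotient.mkₐ_eq_mk]
    exact Ideal.Quotient.eq_zero_iff_mem.2 (Ideal.mem_span_singleton_self _)
  rw [aeval_cayley_eq_sum] at h0
  refine tropVanish_of_sum_eq_zero hw (fun d => ?_) h0
  rw [hx]
  exact hwξ _

lemma pairR_cayleyWt (u : Fin 2 × Fin 2 × Fin 2) (τ : Fin 2 ⊕ Fin 2 ⊕ Fin 2 → ℝ) :
    pairR (cayleyWt u) τ = τ (Sum.inl u.1) + τ (Sum.inr (Sum.inl u.2.1))
      + τ (Sum.inr (Sum.inr u.2.2)) := by
  obtain ⟨i, j, k⟩ := u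
  simp [pairR, cayleyWt, Pi.single_apply, add_assoc]

/-- The element of the torus which carries the normalised point of an orbit to `ξ`. -/
def orbitParam (ξ : Fin 2 × Fin 2 × Fin 2 → ℝ) : Fin 2 ⊕ Fin 2 ⊕ Fin 2 → ℝ :=
  Sum.elim
    (fun i => min (ξ (i, 0, 0) + ξ (i, 1, 1)) (ξ (i, 0, 1) + ξ (i, 1, 0)) / 2 - (∑ u, ξ u) / 12)
    (Sum.elim
      (fun j => min (ξ (0, j, 0) + ξ (1, j, 1)) (ξ (0, j, 1) + ξ (1, j, 0)) / 2 - (∑ u, ξ u) / 12)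
      fun k => min (ξ (0, 0, k) + ξ (1, 1, k)) (ξ (0, 1, k) + ξ (1, 0, k)) / 2 - (∑ u, ξ u) / 12)

/-- The normalised point in the orbit of `ξ`. -/
def orbitRep (ξ : Fin 2 × Fin 2 × Fin 2 → ℝ) (d : Bool × Fin 4) : ℝ :=
  ξ (vertexEquiv.symm d) - pairR (cayleyWt (vertexEquiv.symm d)) (orbitParam ξ)

lemma continuous_orbitParam : Continuous orbitParam := by
  refine continuous_pi fun s => ?_
  rcases s with s | s | s <;> simp only [orbitParam, Sum.elim_inl, Sum.elim_inr] <;> fun_prop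

lemma continuous_pairR {X M : Type*} [TopologicalSpace X] [Fintype M] (β : M → ℤ)
    {τ : X → M → ℝ} (hτ : Continuous τ) : Continuous fun x => pairR β (τ x) := by
  unfold pairR
  fun_prop

lemma continuous_orbitRep : Continuous orbitRep :=
  continuous_pi fun _ => (continuous_apply _).sub (continuous_pairR _ continuous_orbitParam)

lemma pairR_orbitParam_add (ξ : Fin 2 × Fin 2 × Fin 2 → ℝ) (δ : Fin 2 ⊕ Fin 2 ⊕ Fin 2 → ℝ)
    (u : Fin 2 × Fin 2 × Fin 2) :
    pairR (cayleyWt u) (orbitParam fun e => ξ e + pairR (cayleyWt e) δ)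
      = pairR (cayleyWt u) (orbitParam ξ + δ) := by
  have hmin : ∀ {a b a' b' : ℝ} (c : ℝ), a' = a + c → b' = b + c → min a' b' = min a b + c := by
    rintro a b _ _ c rfl rfl
    exact min_add_add_right a b c
  obtain ⟨ξ', hξ'⟩ : ∃ ξ' : Fin 2 × Fin 2 × Fin 2 → ℝ, ξ' = fun e => ξ e + pairR (cayleyWt e) δ :=
    ⟨_, rfl⟩
  rw [← hξ']
  have he : ∀ e, ξ' e = ξ e + (δ (Sum.inl e.1) + δ (Sum.inr (Sum.inl e.2.1))
      + δ (Sum.inr (Sum.inr e.2.2))) := fun e => by simp only [hξ', pairR_cayleyWt]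
  have hsum : (∑ e, ξ' e) = ∑ e, ξ e + 4 * (δ (Sum.inl 0) + δ (Sum.inl 1)
      + (δ (Sum.inr (Sum.inl 0)) + δ (Sum.inr (Sum.inl 1)))
      + (δ (Sum.inr (Sum.inr 0)) + δ (Sum.inr (Sum.inr 1)))) := by
    simp only [he, Fintype.sum_prod_type, Fin.sum_univ_two]
    ring
  obtain ⟨i, j, k⟩ := u
  have hx : min (ξ' (i, 0, 0) + ξ' (i, 1, 1)) (ξ' (i, 0, 1) + ξ' (i, 1, 0))
      = min (ξ (i, 0, 0) + ξ (i, 1, 1)) (ξ (i, 0, 1) + ξ (i, 1, 0))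
        + (2 * δ (Sum.inl i) + δ (Sum.inr (Sum.inl 0)) + δ (Sum.inr (Sum.inl 1))
          + δ (Sum.inr (Sum.inr 0)) + δ (Sum.inr (Sum.inr 1))) :=
    hmin _ (by simp only [he]; ring) (by simp only [he]; ring)
  have hy : min (ξ' (0, j, 0) + ξ' (1, j, 1)) (ξ' (0, j, 1) + ξ' (1, j, 0))
      = min (ξ (0, j, 0) + ξ (1, j, 1)) (ξ (0, j, 1) + ξ (1, j, 0))
        + (2 * δ (Sum.inr (Sum.inl j)) + δ (Sum.inl 0) + δ (Sum.inl 1)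
          + δ (Sum.inr (Sum.inr 0)) + δ (Sum.inr (Sum.inr 1))) :=
    hmin _ (by simp only [he]; ring) (by simp only [he]; ring)
  have hz : min (ξ' (0, 0, k) + ξ' (1, 1, k)) (ξ' (0, 1, k) + ξ' (1, 0, k))
      = min (ξ (0, 0, k) + ξ (1, 1, k)) (ξ (0, 1, k) + ξ (1, 0, k))
        + (2 * δ (Sum.inr (Sum.inr k)) + δ (Sum.inl 0) + δ (Sum.inl 1)
          + δ (Sum.inr (Sum.inl 0)) + δ (Sum.inr (Sum.inl 1))) :=
    hmin _ (by simp only [he]; ring) (by simp only [he]; ring)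
  simp only [pairR_cayleyWt, orbitParam, Sum.elim_inl, Sum.elim_inr, Pi.add_apply, hsum, hx, hy,
    hz]
  ring

lemma orbitRep_add (ξ : Fin 2 × Fin 2 × Fin 2 → ℝ) (δ : Fin 2 ⊕ Fin 2 ⊕ Fin 2 → ℝ) :
    (orbitRep fun e => ξ e + pairR (cayleyWt e) δ) = orbitRep ξ := by
  funext d
  rw [orbitRep, pairR_orbitParam_add, pairR_add, orbitRep]
  ring

lemma normalized_orbitRep (ξ : Fin 2 × Fin 2 × Fin 2 → ℝ) : Normalized (orbitRep ξ) := by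
  have hmin : ∀ {a b a' b' : ℝ} (c : ℝ), a' = a - c → b' = b - c → min a' b' = min a b - c := by
    rintro a b _ _ c rfl rfl
    exact min_sub_sub_right a b c
  have hr : ∀ d, orbitRep ξ d = ξ (vertexEquiv.symm d)
      - (orbitParam ξ (Sum.inl (vertexEquiv.symm d).1)
        + orbitParam ξ (Sum.inr (Sum.inl (vertexEquiv.symm d).2.1))
        + orbitParam ξ (Sum.inr (Sum.inr (vertexEquiv.symm d).2.2))) :=
    fun d => by rw [← pairR_cayleyWt, orbitRep]
  have hx : ∀ i, orbitParam ξ (Sum.inl i)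
      = min (ξ (i, 0, 0) + ξ (i, 1, 1)) (ξ (i, 0, 1) + ξ (i, 1, 0)) / 2 - (∑ u, ξ u) / 12 :=
    fun _ => rfl
  have hy : ∀ j, orbitParam ξ (Sum.inr (Sum.inl j))
      = min (ξ (0, j, 0) + ξ (1, j, 1)) (ξ (0, j, 1) + ξ (1, j, 0)) / 2 - (∑ u, ξ u) / 12 :=
    fun _ => rfl
  have hz : ∀ k, orbitParam ξ (Sum.inr (Sum.inr k))
      = min (ξ (0, 0, k) + ξ (1, 1, k)) (ξ (0, 1, k) + ξ (1, 0, k)) / 2 - (∑ u, ξ u) / 12 :=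
    fun _ => rfl
  have r000 : orbitRep ξ (false, 0) = ξ (0, 0, 0) - (orbitParam ξ (Sum.inl 0)
      + orbitParam ξ (Sum.inr (Sum.inl 0)) + orbitParam ξ (Sum.inr (Sum.inr 0))) := hr _
  have r011 : orbitRep ξ (false, 1) = ξ (0, 1, 1) - (orbitParam ξ (Sum.inl 0)
      + orbitParam ξ (Sum.inr (Sum.inl 1)) + orbitParam ξ (Sum.inr (Sum.inr 1))) := hr _
  have r101 : orbitRep ξ (false, 2) = ξ (1, 0, 1) - (orbitParam ξ (Sum.inl 1)
      + orbitParam ξ (Sum.inr (Sum.inl 0)) + orbitParam ξ (Sum.inr (Sum.inr 1))) := hr _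
  have r110 : orbitRep ξ (false, 3) = ξ (1, 1, 0) - (orbitParam ξ (Sum.inl 1)
      + orbitParam ξ (Sum.inr (Sum.inl 1)) + orbitParam ξ (Sum.inr (Sum.inr 0))) := hr _
  have r111 : orbitRep ξ (true, 0) = ξ (1, 1, 1) - (orbitParam ξ (Sum.inl 1)
      + orbitParam ξ (Sum.inr (Sum.inl 1)) + orbitParam ξ (Sum.inr (Sum.inr 1))) := hr _
  have r100 : orbitRep ξ (true, 1) = ξ (1, 0, 0) - (orbitParam ξ (Sum.inl 1)
      + orbitParam ξ (Sum.inr (Sum.inl 0)) + orbitParam ξ (Sum.inr (Sum.inr 0))) := hr _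
  have r010 : orbitRep ξ (true, 2) = ξ (0, 1, 0) - (orbitParam ξ (Sum.inl 0)
      + orbitParam ξ (Sum.inr (Sum.inl 1)) + orbitParam ξ (Sum.inr (Sum.inr 0))) := hr _
  have r001 : orbitRep ξ (true, 3) = ξ (0, 0, 1) - (orbitParam ξ (Sum.inl 0)
      + orbitParam ξ (Sum.inr (Sum.inl 0)) + orbitParam ξ (Sum.inr (Sum.inr 1))) := hr _
  generalize orbitRep ξ = η at *
  generalize orbitParam ξ = τ at *
  have mx0 : min (η (false, 0) + η (false, 1)) (η (true, 2) + η (true, 3))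
      = min (ξ (0, 0, 0) + ξ (0, 1, 1)) (ξ (0, 1, 0) + ξ (0, 0, 1))
        - (2 * τ (Sum.inl 0) + τ (Sum.inr (Sum.inl 0)) + τ (Sum.inr (Sum.inl 1))
        + τ (Sum.inr (Sum.inr 0)) + τ (Sum.inr (Sum.inr 1))) :=
    hmin _ (by rw [r000, r011]; ring) (by rw [r010, r001]; ring)
  have mx1 : min (η (false, 2) + η (false, 3)) (η (true, 0) + η (true, 1))
      = min (ξ (1, 0, 1) + ξ (1, 1, 0)) (ξ (1, 1, 1) + ξ (1, 0, 0))
        - (2 * τ (Sum.inl 1) + τ (Sum.inr (Sum.inl 0)) + τ (Sum.inr (Sum.inl 1))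
        + τ (Sum.inr (Sum.inr 0)) + τ (Sum.inr (Sum.inr 1))) :=
    hmin _ (by rw [r101, r110]; ring) (by rw [r111, r100]; ring)
  have my0 : min (η (false, 0) + η (false, 2)) (η (true, 1) + η (true, 3))
      = min (ξ (0, 0, 0) + ξ (1, 0, 1)) (ξ (1, 0, 0) + ξ (0, 0, 1))
        - (2 * τ (Sum.inr (Sum.inl 0)) + τ (Sum.inl 0) + τ (Sum.inl 1)
        + τ (Sum.inr (Sum.inr 0)) + τ (Sum.inr (Sum.inr 1))) :=
    hmin _ (by rw [r000, r101]; ring) (by rw [r100, r001]; ring)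
  have my1 : min (η (false, 1) + η (false, 3)) (η (true, 0) + η (true, 2))
      = min (ξ (0, 1, 1) + ξ (1, 1, 0)) (ξ (1, 1, 1) + ξ (0, 1, 0))
        - (2 * τ (Sum.inr (Sum.inl 1)) + τ (Sum.inl 0) + τ (Sum.inl 1)
        + τ (Sum.inr (Sum.inr 0)) + τ (Sum.inr (Sum.inr 1))) :=
    hmin _ (by rw [r011, r110]; ring) (by rw [r111, r010]; ring)
  have mz0 : min (η (false, 0) + η (false, 3)) (η (true, 1) + η (true, 2))
      = min (ξ (0, 0, 0) + ξ (1, 1, 0)) (ξ (1, 0, 0) + ξ (0, 1, 0))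
        - (2 * τ (Sum.inr (Sum.inr 0)) + τ (Sum.inl 0) + τ (Sum.inl 1)
        + τ (Sum.inr (Sum.inl 0)) + τ (Sum.inr (Sum.inl 1))) :=
    hmin _ (by rw [r000, r110]; ring) (by rw [r100, r010]; ring)
  have mz1 : min (η (false, 1) + η (false, 2)) (η (true, 0) + η (true, 3))
      = min (ξ (0, 1, 1) + ξ (1, 0, 1)) (ξ (1, 1, 1) + ξ (0, 0, 1))
        - (2 * τ (Sum.inr (Sum.inr 1)) + τ (Sum.inl 0) + τ (Sum.inl 1)
        + τ (Sum.inr (Sum.inl 0)) + τ (Sum.inr (Sum.inl 1))) :=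
    hmin _ (by rw [r011, r101]; ring) (by rw [r111, r001]; ring)
  refine normalized_of_splittings ?_ ?_ ?_
  · rw [mx0, mx1]
    grind
  · rw [my0, my1]
    grind
  · rw [mz0, mz1]
    grind

lemma TropVanish.orbitRep {V : RInf} {ξ : Fin 2 × Fin 2 × Fin 2 → ℝ}
    (h : TropVanish V (ξ ∘ vertexEquiv.symm)) : TropVanish V (orbitRep ξ) := by
  refine h.of_sub (∑ s, orbitParam ξ s) (fun i => ?_) fun b => ?_
  · fin_cases i <;> simp [diagSum, _root_.orbitRep, pairR_cayleyWt, vertexEquiv] <;> ring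
  · cases b <;> simp [paritySum, _root_.orbitRep, pairR_cayleyWt, vertexEquiv,
      Fin.sum_univ_four] <;> ring

end Hyperdeterminant

section EquivariantSection

variable {K : Type*} [Field K] {v : K → RInf}

lemma torusHom_eq_zero_of_mem_span_cayley {A : Type*} [CommRing A] [Algebra K A]
    {q : Bool × Fin 4 → A} (hq : IsLPoint q) :
    ∀ F ∈ Ideal.span {cayley K}, torusHom cayleyWt (q ∘ vertexEquiv) F = 0 := by
  intro F hF
  obtain ⟨G, rfl⟩ := Ideal.mem_span_singleton'.1 hF
  rw [map_mul, torusHom_cayley, hq.aeval_cayley, AddMonoidAlgebra.single_zero, mul_zero]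

lemma wtHomog_span_cayley : WtHomog cayleyWt (Ideal.span {cayley K}) := by
  refine wtHomog_span_singleton cayleyWt (β₀ := fun _ => 2) ?_
  rw [torusHom_cayley, MvPolynomial.aeval_X_left_apply]

/-- The section of the tropicalisation map given by a chart. -/
def Chart.sectionVal (v : K → RInf) (c : Chart) (ξ : Fin 2 × Fin 2 × Fin 2 → ℝ) :
    (MvPolynomial (Fin 2 × Fin 2 × Fin 2) K ⧸ Ideal.span {cayley K}) → RInf :=
  torusVal (torusHom_eq_zero_of_mem_span_cayley c.isLPoint_form) (c.val v (orbitRep ξ))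
    (orbitParam ξ)

lemma Chart.sectionVal_eq (hv : IsVal v) {c c' : Chart} {ξ : Fin 2 × Fin 2 × Fin 2 → ℝ}
    (h : c.Valid v (orbitRep ξ)) (h' : c'.Valid v (orbitRep ξ)) :
    c.sectionVal v ξ = c'.sectionVal v ξ :=
  torusVal_congr _ _ (c.val_mem_An hv _).1.map_zero (c'.val_mem_An hv _).1.map_zero
    (Chart.val_aeval_eq hv h h' vertexEquiv) fun _ => rfl

lemma Chart.tropMap_torusVal_eq (hv : IsVal v) {c : Chart} {ξ : Fin 2 × Fin 2 × Fin 2 → ℝ}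
    (h : c.Valid v (orbitRep ξ)) (τ : Fin 2 ⊕ Fin 2 ⊕ Fin 2 → ℝ) (e : Fin 2 × Fin 2 × Fin 2) :
    tropMap (Ideal.span {cayley K}) (torusVal
      (torusHom_eq_zero_of_mem_span_cayley c.isLPoint_form) (c.val v (orbitRep ξ))
      (orbitParam ξ + τ)) e = ((ξ e + pairR (cayleyWt e) τ : ℝ) : RInf) := by
  rw [tropMap_torusVal _ (c.val_mem_An hv _), Function.comp_apply, h, ← WithTop.coe_add,
    pairR_add, orbitRep, Equiv.symm_apply_apply]
  congr 1
  ring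

lemma Chart.sectionVal_add (hv : IsVal v) {c : Chart} (ξ : Fin 2 × Fin 2 × Fin 2 → ℝ)
    (τ : Fin 2 ⊕ Fin 2 ⊕ Fin 2 → ℝ) :
    c.sectionVal v (fun e => ξ e + pairR (cayleyWt e) τ)
      = mu cayleyWt (Ideal.span {cayley K}) τ (c.sectionVal v ξ) := by
  have h0 := (c.val_mem_An hv (orbitRep ξ)).1.map_zero
  rw [Chart.sectionVal, Chart.sectionVal, mu_torusVal _ h0]
  refine torusVal_congr _ _ ?_ h0 (fun F => ?_) (pairR_orbitParam_add ξ τ)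
  · rwa [orbitRep_add]
  · rw [orbitRep_add]

lemma Chart.continuous_sectionVal (hv : IsVal v) (c : Chart) :
    Continuous (c.sectionVal v : _ → _ → RInf) := by
  refine continuous_pi fun f => ?_
  obtain ⟨F, rfl⟩ := Ideal.Quotient.mk_surjective f
  simp_rw [Chart.sectionVal, torusVal_mk _ (c.val_mem_An hv _).1.map_zero]
  refine continuous_finset_inf _ _ fun β => continuous_mvGauss_add ?_
    (continuous_pairR _ continuous_orbitParam) _
  exact continuous_pi fun k => (continuous_apply (c.basis k)).comp continuous_orbitRep

lemma Chart.isClosed_valid (v : K → RInf) (c : Chart) :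
    IsClosed {ξ | c.Valid v (orbitRep ξ)} := by
  simp only [Chart.Valid, Set.ofPred_forall]
  refine isClosed_iInter fun u => isClosed_eq ?_ ?_
  · have h := continuous_mvGauss_add (v := v) (ρ := fun ξ => orbitRep ξ ∘ c.basis)
      (continuous_pi fun k => (continuous_apply (c.basis k)).comp continuous_orbitRep)
      (continuous_const (y := (0 : ℝ))) (c.form K u)
    simpa only [WithTop.coe_zero, add_zero, Chart.val] using h
  · exact WithTop.continuous_coe.comp ((continuous_apply u).comp continuous_orbitRep)

lemma exists_valid_orbitRep (hv : IsVal v) {ξ : Fin 2 × Fin 2 × Fin 2 → ℝ}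
    (hξ : ξ ∈ TropSet0 v (Ideal.span {cayley K})) : ∃ c : Chart, c.Valid v (orbitRep ξ) :=
  exists_valid_of_tropVanish hv (normalized_orbitRep ξ) (tropVanish_of_mem_tropSet0 hξ).orbitRep

end EquivariantSection

end

/-- The principal ideal generated by Cayley's hyperdeterminant is
weight-homogeneous for the weights `a_{ijk} = (e_i,e_j,e_k)`, and
`trop : X^an → Trop(X⁰)` admits a continuous, `ℝ²×ℝ²×ℝ²`-equivariant section over
the finite part `Trop(X⁰) ⊆ ℝ⁸`: `σ(ξ + Aτ) = μ(τ, σ(ξ))` with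
`(Aτ)_{ijk} = a_{ijk}·τ`. -/
theorem hyperdeterminant_has_equivariant_section
    {K : Type*} [Field K] (v : K → RInf) (hv : IsVal v)
    (hsurj : Function.Surjective v) :
    WtHomog cayleyWt (Ideal.span {cayley K}) ∧
    ∃ σ : TropSet0 v (Ideal.span {cayley K}) →
        {w : (MvPolynomial (Fin 2 × Fin 2 × Fin 2) K ⧸ Ideal.span {cayley K}) → RInf //
          w ∈ An v (MvPolynomial (Fin 2 × Fin 2 × Fin 2) K ⧸ Ideal.span {cayley K})},
      Continuous σ ∧
      (∀ ξ : TropSet0 v (Ideal.span {cayley K}), ∀ e : Fin 2 × Fin 2 × Fin 2,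
        tropMap (Ideal.span {cayley K}) (σ ξ).val e
          = (((ξ : (Fin 2 × Fin 2 × Fin 2) → ℝ) e : ℝ) : RInf)) ∧
      (∀ (ξ : TropSet0 v (Ideal.span {cayley K})) (τ : (Fin 2 ⊕ Fin 2 ⊕ Fin 2) → ℝ),
        ∃ h : (fun e : Fin 2 × Fin 2 × Fin 2 =>
            (ξ : (Fin 2 × Fin 2 × Fin 2) → ℝ) e + pairR (cayleyWt e) τ)
              ∈ TropSet0 v (Ideal.span {cayley K}),
          (σ ⟨_, h⟩).val
            = mu cayleyWt (Ideal.span {cayley K}) τ (σ ξ).val) := by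
  refine ⟨wtHomog_span_cayley, ?_⟩
  choose c hc using fun ξ : TropSet0 v (Ideal.span {cayley K}) => exists_valid_orbitRep hv ξ.2
  refine ⟨fun ξ => ⟨(c ξ).sectionVal v ξ.1, torusVal_mem_An _ ((c ξ).val_mem_An hv _) _⟩,
    Continuous.subtype_mk ?_ _, fun ξ e => ?_, fun ξ τ => ?_⟩
  · refine (locallyFinite_of_finite fun c : Chart =>
      {ξ : TropSet0 v (Ideal.span {cayley K}) | c.Valid v (orbitRep ξ.1)}).continuous
      (Set.eq_univ_of_forall fun ξ => Set.mem_iUnion.2 ⟨c ξ, hc ξ⟩)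
      (fun d => (d.isClosed_valid v).preimage continuous_subtype_val) fun d => ?_
    exact ((d.continuous_sectionVal hv).comp continuous_subtype_val).continuousOn.congr
      fun ξ hξ => Chart.sectionVal_eq hv (hc ξ) hξ
  · have h := Chart.tropMap_torusVal_eq hv (hc ξ) 0 e
    simpa only [add_zero, pairR, Pi.zero_apply, mul_zero, Finset.sum_const_zero,
      Chart.sectionVal] using h
  · have h : (fun e => ξ.1 e + pairR (cayleyWt e) τ) ∈ TropSet0 v (Ideal.span {cayley K}) :=
      ⟨_, torusVal_mem_An _ ((c ξ).val_mem_An hv _) _, Chart.tropMap_torusVal_eq hv (hc ξ) τ⟩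
    refine ⟨h, ?_⟩
    have hcξ := hc ⟨_, h⟩
    rw [orbitRep_add] at hcξ
    change (c ⟨_, h⟩).sectionVal v _ = mu _ _ τ ((c ξ).sectionVal v ξ.1)
    rw [Chart.sectionVal_add hv, Chart.sectionVal_eq hv hcξ (hc ξ)]
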